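/- arXiv:0910.5945 — 4 statements merged into one kernel-verified Lean document; each statement's English description precedes it below -/
import Mathlib

section
/- For every integer n ≥ 4, 4 times the number of pairs (w, A), where w is a reduced word for the long word w0 in S_n and A is a 4-element subset of {1,...,n} such that the induced word of w on A belongs to the reentrant set X, equals C(n,4) times the total number of reduced words for w0 in S_n. Equivalently, if a reduced word for w0 in S_n is chosen uniformly at random and, independently, a 4-element subset of {1,...,n} is chosen uniformly at random, the probability that the induced reduced word for the long word in S_4 is reentrant equals 1/4. -/
/-- The adjacent transposition `s_a`, swapping `a` and `a+1`, as a permutation of `ℕ`. -/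
def adjTransposition (a : ℕ) : Equiv.Perm ℕ := Equiv.swap a (a + 1)

/-- The long word `w₀ = [n, n-1, …, 2, 1]` in `S_n`: the permutation of `ℕ` sending
`i` to `n + 1 - i` for `i ∈ {1, …, n}` and fixing all other natural numbers. -/
def longWord (n : ℕ) : Equiv.Perm ℕ :=
  Function.Involutive.toPerm (fun i => if 1 ≤ i ∧ i ≤ n then n + 1 - i else i)
    (by intro i; dsimp only; split_ifs <;> omega)

/-- `w` is a reduced word for the long word in `S_n`: a sequence of letters in
`{1, …, n-1}` of length `C(n,2)` whose associated product of adjacent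
transpositions `s_{a_1} s_{a_2} ⋯ s_{a_m}` equals `w₀`. -/
def IsReducedWord (n : ℕ) (w : List ℕ) : Prop :=
  w.length = n.choose 2 ∧ (∀ a ∈ w, 1 ≤ a ∧ a ≤ n - 1) ∧
    (w.map adjTransposition).prod = longWord n

/-- Auxiliary recursion computing the induced word on a subset `A` of wires:
`π` is the current permutation `π_{k-1}` (with `π j` the wire in position `j`);
at a step with letter `a`, the wires `π a` and `π (a+1)` cross, and if both lie
in `A` we record the position of `a` among the positions currently occupied by
the wires of `A`. -/
def inducedAux (A : Finset ℕ) : List ℕ → Equiv.Perm ℕ → List ℕ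
  | [], _ => []
  | a :: rest, π =>
      (if π a ∈ A ∧ π (a + 1) ∈ A
        then [((Finset.Icc 1 a).filter (fun p => π p ∈ A)).card]
        else []) ++ inducedAux A rest (π * adjTransposition a)

/-- The induced word of the word `w` on the subset `A` of wires. -/
def inducedWord (w : List ℕ) (A : Finset ℕ) : List ℕ := inducedAux A w 1

/-- The reentrant set `X` of four reduced words for the long word in `S_4`. -/
def reentrantSet : Finset (List ℕ) :=
  {[1,2,3,2,1,2], [3,2,1,2,3,2], [2,1,2,3,2,1], [2,3,2,1,2,3]}

open Finset

namespace SortingNetwork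

/-! ### Adjacent transpositions and inversions -/

theorem adj_apply (a i : ℕ) :
    adjTransposition a i = if i = a then a + 1 else if i = a + 1 then a else i :=
  Equiv.swap_apply_def a (a + 1) i

theorem adj_mul_self (a : ℕ) : adjTransposition a * adjTransposition a = 1 :=
  Equiv.swap_mul_self a (a + 1)

theorem adj_adj (a i : ℕ) : adjTransposition a (adjTransposition a i) = i :=
  Equiv.swap_apply_self a (a + 1) i

/-- The number of inversions of `π` on the window `{1, …, n}`. -/
def inv (n : ℕ) (π : Equiv.Perm ℕ) : ℕ :=
  #{p ∈ Icc 1 n ×ˢ Icc 1 n | p.1 < p.2 ∧ π p.2 < π p.1}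

theorem inv_mul_adj_of_lt {n a : ℕ} {π : Equiv.Perm ℕ} (ha : 1 ≤ a) (han : a + 1 ≤ n)
    (h : π a < π (a + 1)) : inv n (π * adjTransposition a) = inv n π + 1 := by
  set s := adjTransposition a with hs
  set S : Finset _ := {p ∈ Icc 1 n ×ˢ Icc 1 n | p.1 < p.2 ∧ π p.2 < π p.1} with hS
  have key : ({p ∈ Icc 1 n ×ˢ Icc 1 n | p.1 < p.2 ∧ (π * s) p.2 < (π * s) p.1} : Finset _)
      = insert (a, a + 1) (S.map (s.prodCongr s).toEmbedding) := by
    ext ⟨i, j⟩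
    have hm : (i, j) ∈ S.map (s.prodCongr s).toEmbedding ↔ (s i, s j) ∈ S := by
      simp only [mem_map, Equiv.coe_toEmbedding, Prod.exists, Equiv.prodCongr_apply, Prod.map,
        Prod.mk.injEq]
      constructor
      · rintro ⟨p, q, hpq, rfl, rfl⟩
        simpa [hs, adj_adj] using hpq
      · exact fun hij => ⟨s i, s j, hij, adj_adj a i, adj_adj a j⟩
    rw [mem_insert, hm]
    rw [hS, mem_filter, mem_filter]
    simp only [mem_product, mem_Icc, Equiv.Perm.mul_apply, Prod.mk.injEq]
    have cases (k : ℕ) : (k = a ∧ s k = a + 1) ∨ (k = a + 1 ∧ s k = a) ∨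
        (k ≠ a ∧ k ≠ a + 1 ∧ s k = k) := by
      rw [hs, adj_apply]
      split_ifs <;> omega
    have hi := cases i
    have hj := cases j
    generalize s i = u at hi ⊢
    generalize s j = v at hj ⊢
    rcases hi with ⟨rfl, rfl⟩ | ⟨rfl, rfl⟩ | ⟨hi1, hi2, rfl⟩ <;>
      rcases hj with ⟨hj, rfl⟩ | ⟨hj, rfl⟩ | ⟨hj1, hj2, rfl⟩ <;> (try subst hj) <;> omega
  have hnot : (a, a + 1) ∉ S.map (s.prodCongr s).toEmbedding := by
    simp only [mem_map, Equiv.coe_toEmbedding, Prod.exists, Equiv.prodCongr_apply, Prod.map,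
      Prod.mk.injEq, not_exists, not_and]
    intro p q hpq hp hq
    have hp' : p = a + 1 := by rw [← adj_adj a p, ← hs, hp, hs, adj_apply, if_pos rfl]
    have hq' : q = a := by
      rw [← adj_adj a q, ← hs, hq, hs, adj_apply, if_neg (by omega), if_pos rfl]
    simp only [hS, mem_filter] at hpq
    omega
  rw [inv, key, card_insert_of_notMem hnot, card_map]
  rfl

theorem inv_mul_adj_of_gt {n a : ℕ} {π : Equiv.Perm ℕ} (ha : 1 ≤ a) (han : a + 1 ≤ n)
    (h : π (a + 1) < π a) : inv n (π * adjTransposition a) + 1 = inv n π := by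
  have := inv_mul_adj_of_lt (π := π * adjTransposition a) ha han
    (by simpa [adj_apply] using h)
  rw [mul_assoc, adj_mul_self, mul_one] at this
  exact this.symm

theorem adj_lt_or_gt (π : Equiv.Perm ℕ) (a : ℕ) : π a < π (a + 1) ∨ π (a + 1) < π a :=
  lt_or_gt_of_ne (π.injective.ne (by omega))

theorem inv_one (n : ℕ) : inv n 1 = 0 := by
  rw [inv, card_eq_zero, filter_eq_empty_iff]
  rintro ⟨i, j⟩ - ⟨h, h'⟩
  simp only [Equiv.Perm.one_apply] at h h'
  omega

/-- `π` fixes everything outside of `{1, …, n}`. -/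
def FixesOutside (n : ℕ) (π : Equiv.Perm ℕ) : Prop := ∀ i, i ∉ Icc 1 n → π i = i

theorem FixesOutside.mul {n : ℕ} {π ρ : Equiv.Perm ℕ} (hπ : FixesOutside n π)
    (hρ : FixesOutside n ρ) : FixesOutside n (π * ρ) := fun i hi => by
  rw [Equiv.Perm.mul_apply, hρ i hi, hπ i hi]

theorem fixesOutside_one (n : ℕ) : FixesOutside n 1 := fun _ _ => rfl

theorem fixesOutside_adj {n a : ℕ} (ha : 1 ≤ a) (han : a + 1 ≤ n) :
    FixesOutside n (adjTransposition a) := fun i hi => by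
  rw [mem_Icc] at hi
  rw [adj_apply, if_neg (by omega), if_neg (by omega)]

theorem FixesOutside.mem_iff {n : ℕ} {π : Equiv.Perm ℕ} (hπ : FixesOutside n π) (i : ℕ) :
    π i ∈ Icc 1 n ↔ i ∈ Icc 1 n := by
  constructor
  · intro h
    by_contra hi
    exact hi (hπ i hi ▸ h)
  · intro h
    by_contra hi
    exact hi ((π.injective (hπ _ hi)).symm ▸ h)

theorem FixesOutside.eq_one {n : ℕ} {π : Equiv.Perm ℕ} (hπ : FixesOutside n π)
    (h : ∀ a, 1 ≤ a → a + 1 ≤ n → π a < π (a + 1)) : π = 1 := by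
  have hmono : StrictMono π := by
    refine strictMono_nat_of_lt_succ fun i => ?_
    have h0 := hπ 0 (by simp)
    by_cases h1 : i = 0
    · subst h1
      rcases Nat.eq_zero_or_pos (π (0 + 1)) with h2 | h2
      · exact absurd (π.injective (h2.trans h0.symm)) (by omega)
      · omega
    by_cases h2 : i + 1 ≤ n
    · exact h i (by omega) h2
    rw [hπ (i + 1) (by simp; omega)]
    by_cases h3 : i ≤ n
    · have := (hπ.mem_iff i).2 (by simp; omega)
      rw [mem_Icc] at this
      omega
    · rw [hπ i (by simp; omega)]
      omega
  have hmono' : StrictMono ⇑π⁻¹ := fun i j hij => by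
    by_contra hc
    have := hmono.monotone (not_lt.1 hc)
    simp at this
    omega
  ext i
  refine le_antisymm ?_ (hmono.le_apply)
  have := hmono'.le_apply (x := π i)
  simpa using this

theorem inv_eq_zero {n : ℕ} {π : Equiv.Perm ℕ} (hπ : FixesOutside n π) (h : inv n π = 0) :
    π = 1 := by
  refine hπ.eq_one fun a ha han => (adj_lt_or_gt π a).resolve_right fun hlt => ?_
  have := inv_mul_adj_of_gt ha han hlt
  omega

theorem longWord_apply {n i : ℕ} (hi : 1 ≤ i) (hin : i ≤ n) : longWord n i = n + 1 - i := by
  change (if 1 ≤ i ∧ i ≤ n then n + 1 - i else i) = _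
  rw [if_pos ⟨hi, hin⟩]

theorem fixesOutside_longWord (n : ℕ) : FixesOutside n (longWord n) := fun i hi => by
  change (if 1 ≤ i ∧ i ≤ n then n + 1 - i else i) = _
  rw [if_neg (by simpa using hi)]

theorem longWord_mul_self (n : ℕ) : longWord n * longWord n = 1 := by
  ext i
  exact (Function.Involutive.toPerm_involutive _) i

theorem longWord_inv (n : ℕ) : (longWord n)⁻¹ = longWord n :=
  inv_eq_of_mul_eq_one_left (longWord_mul_self n)

theorem card_lt_pairs (n : ℕ) : #{p ∈ Icc 1 n ×ˢ Icc 1 n | p.1 < p.2} = n.choose 2 := by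
  have : ({p ∈ Icc 1 n ×ˢ Icc 1 n | p.1 < p.2} : Finset (ℕ × ℕ))
      = (range n).biUnion fun j => (range j).image fun i => (i + 1, j + 1) := by
    ext ⟨i, j⟩
    simp only [mem_filter, mem_product, mem_Icc, mem_biUnion, mem_range, mem_image, Prod.mk.injEq]
    constructor
    · exact fun h => ⟨j - 1, by omega, i - 1, by omega, by omega, by omega⟩
    · rintro ⟨j', hj, i', hi, rfl, rfl⟩
      omega
  rw [this, card_biUnion, Nat.choose_two_right, ← sum_range_id]
  · refine sum_congr rfl fun j _ => ?_
    rw [card_image_of_injective _ fun i i' h => by simpa using h, card_range]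
  · intro j _ j' _ hne
    rw [Function.onFun, disjoint_left]
    rintro ⟨p, q⟩ h h'
    simp only [mem_image, Prod.mk.injEq] at h h'
    obtain ⟨_, _, _, rfl⟩ := h
    obtain ⟨_, _, _, h⟩ := h'
    omega

theorem inv_longWord (n : ℕ) : inv n (longWord n) = n.choose 2 := by
  rw [← card_lt_pairs, inv]
  congr 1
  refine filter_congr ?_
  rintro ⟨i, j⟩ hp
  simp only [mem_product, mem_Icc] at hp
  dsimp only
  rw [longWord_apply hp.1.1 hp.1.2, longWord_apply hp.2.1 hp.2.2]
  omega

theorem eq_longWord_of_inv {n : ℕ} {π : Equiv.Perm ℕ} (hπ : FixesOutside n π)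
    (h : inv n π = n.choose 2) : π = longWord n := by
  have hall : ∀ i j, 1 ≤ i → i < j → j ≤ n → π j < π i := by
    intro i j hi hij hj
    rw [← card_lt_pairs, inv, ← filter_filter] at h
    have := (filter_eq_self.1 (eq_of_subset_of_card_le (filter_subset _ _) h.ge)) (x := (i, j))
    exact this (by simp; omega)
  have := (hπ.mul (fixesOutside_longWord n)).eq_one fun a ha han => by
    rw [Equiv.Perm.mul_apply, Equiv.Perm.mul_apply, longWord_apply ha (by omega),
      longWord_apply (by omega) han]
    exact hall _ _ (by omega) (by omega) (by omega)
  rw [← longWord_inv, ← mul_eq_one_iff_eq_inv, this]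

/-! ### Words and their permutations -/

/-- All letters of `w` lie in `{1, …, n-1}`. -/
def IsWord (n : ℕ) (w : List ℕ) : Prop := ∀ a ∈ w, 1 ≤ a ∧ a + 1 ≤ n

theorem isWord_cons {n a : ℕ} {w : List ℕ} :
    IsWord n (a :: w) ↔ (1 ≤ a ∧ a + 1 ≤ n) ∧ IsWord n w := List.forall_mem_cons

/-- The inverse of the product of the adjacent transpositions listed in `w`. -/
def wordPerm : List ℕ → Equiv.Perm ℕ
  | [] => 1
  | a :: w => wordPerm w * adjTransposition a

theorem wordPerm_eq (w : List ℕ) : wordPerm w = (w.map adjTransposition).prod⁻¹ := by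
  induction w with
  | nil => simp [wordPerm]
  | cons a w ih =>
    rw [wordPerm, ih, List.map_cons, List.prod_cons, mul_inv_rev,
      inv_eq_of_mul_eq_one_left (adj_mul_self a)]

theorem IsWord.fixesOutside {n : ℕ} {w : List ℕ} (hw : IsWord n w) :
    FixesOutside n (wordPerm w) := by
  induction w with
  | nil => exact fixesOutside_one n
  | cons a w ih =>
    rw [isWord_cons] at hw
    exact (ih hw.2).mul (fixesOutside_adj hw.1.1 hw.1.2)

theorem IsWord.inv_le {n : ℕ} {w : List ℕ} (hw : IsWord n w) :
    inv n (wordPerm w) ≤ w.length := by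
  induction w with
  | nil => simp [wordPerm, inv_one]
  | cons a w ih =>
    rw [isWord_cons] at hw
    have := ih hw.2
    rw [wordPerm, List.length_cons]
    rcases adj_lt_or_gt (wordPerm w) a with h | h
    · have := inv_mul_adj_of_lt hw.1.1 hw.1.2 h
      omega
    · have := inv_mul_adj_of_gt hw.1.1 hw.1.2 h
      omega

theorem FixesOutside.exists_word {n : ℕ} {π : Equiv.Perm ℕ} (hπ : FixesOutside n π) :
    ∃ w, IsWord n w ∧ wordPerm w = π ∧ w.length = inv n π := by
  induction hN : inv n π generalizing π with
  | zero => exact ⟨[], by simp [IsWord], (inv_eq_zero hπ hN).symm, rfl⟩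
  | succ N ih =>
    have : ∃ a, (1 ≤ a ∧ a + 1 ≤ n) ∧ π (a + 1) < π a := by
      by_contra! hc
      rw [hπ.eq_one fun a ha han => (adj_lt_or_gt π a).resolve_right (hc a ⟨ha, han⟩).not_gt,
        inv_one] at hN
      omega
    obtain ⟨a, ha, h⟩ := this
    have h1 := inv_mul_adj_of_gt ha.1 ha.2 h
    obtain ⟨w, hw, hwp, hwl⟩ := ih (hπ.mul (fixesOutside_adj ha.1 ha.2)) (by omega)
    refine ⟨a :: w, isWord_cons.2 ⟨ha, hw⟩, ?_, by simp [hwl]⟩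
    rw [wordPerm, hwp, mul_assoc, adj_mul_self, mul_one]

/-- `w` is a reduced word of its permutation. -/
def Reduced (n : ℕ) (w : List ℕ) : Prop := IsWord n w ∧ inv n (wordPerm w) = w.length

theorem reduced_cons {n a : ℕ} {w : List ℕ} :
    Reduced n (a :: w) ↔
      (1 ≤ a ∧ a + 1 ≤ n) ∧ Reduced n w ∧ wordPerm w a < wordPerm w (a + 1) := by
  rw [Reduced, Reduced, isWord_cons, wordPerm, List.length_cons]
  constructor
  · rintro ⟨⟨ha, hw⟩, h⟩
    have := hw.inv_le
    rcases adj_lt_or_gt (wordPerm w) a with h' | h'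
    · have := inv_mul_adj_of_lt ha.1 ha.2 h'
      exact ⟨ha, ⟨hw, by omega⟩, h'⟩
    · have := inv_mul_adj_of_gt ha.1 ha.2 h'
      omega
  · rintro ⟨ha, ⟨hw, h⟩, h'⟩
    have := inv_mul_adj_of_lt ha.1 ha.2 h'
    exact ⟨⟨ha, hw⟩, by omega⟩

theorem FixesOutside.exists_reduced {n : ℕ} {π : Equiv.Perm ℕ} (hπ : FixesOutside n π) :
    ∃ w, Reduced n w ∧ wordPerm w = π := by
  obtain ⟨w, hw, rfl, hl⟩ := hπ.exists_word
  exact ⟨w, ⟨hw, hl.symm⟩, rfl⟩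

theorem adj_comm {a b : ℕ} (h : a + 2 ≤ b) :
    adjTransposition a * adjTransposition b = adjTransposition b * adjTransposition a := by
  ext i
  simp only [Equiv.Perm.mul_apply, adj_apply]
  split_ifs <;> omega

theorem adj_braid (a : ℕ) :
    adjTransposition a * adjTransposition (a + 1) * adjTransposition a =
      adjTransposition (a + 1) * adjTransposition a * adjTransposition (a + 1) := by
  ext i
  simp only [Equiv.Perm.mul_apply, adj_apply]
  split_ifs <;> omega

/-! ### Matsumoto's theorem for nil-Coxeter relations -/

/-- A family satisfying the relations of the nil-Coxeter algebra of type `A`. -/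
structure IsNilCoxeter {G : Type*} [MonoidWithZero G] (d : ℕ → G) : Prop where
  sq : ∀ a, d a * d a = 0
  comm : ∀ a b, a + 2 ≤ b → d a * d b = d b * d a
  braid : ∀ a, d a * d (a + 1) * d a = d (a + 1) * d a * d (a + 1)

section NilCoxeter

variable {G : Type*} [MonoidWithZero G] {d : ℕ → G}

/-- If two different letters can start a reduced word of `π`, then there are reduced words of `π`
starting with them which have the same value in the nil-Coxeter algebra. -/
theorem IsNilCoxeter.exists_common (hd : IsNilCoxeter d) {n a b : ℕ} {u v : List ℕ}
    (hab : a < b) (hu : Reduced n (a :: u)) (hv : Reduced n (b :: v))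
    (h : wordPerm (a :: u) = wordPerm (b :: v)) :
    ∃ u' v', Reduced n (a :: u') ∧ wordPerm (a :: u') = wordPerm (a :: u) ∧
      Reduced n (b :: v') ∧ wordPerm (b :: v') = wordPerm (a :: u) ∧
      ((a :: u').map d).prod = ((b :: v').map d).prod := by
  obtain ⟨ha, hu, hlt⟩ := reduced_cons.1 hu
  obtain ⟨hb, hv, hlt'⟩ := reduced_cons.1 hv
  have hadj := fixesOutside_adj ha.1 ha.2
  have hadj' := fixesOutside_adj hb.1 hb.2
  have hπu : wordPerm u = wordPerm (a :: u) * adjTransposition a := by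
    rw [wordPerm, mul_assoc, adj_mul_self, mul_one]
  have hπv : wordPerm v = wordPerm (a :: u) * adjTransposition b := by
    rw [h, wordPerm, mul_assoc, adj_mul_self, mul_one]
  have hπ : FixesOutside n (wordPerm (a :: u)) := hu.1.fixesOutside.mul hadj
  generalize wordPerm (a :: u) = π at *
  rw [hπu] at hlt
  rw [hπv] at hlt'
  by_cases hc : a + 2 ≤ b
  · obtain ⟨w, hw, hwp⟩ := ((hπ.mul hadj).mul hadj').exists_reduced
    have e1 : wordPerm (b :: w) = π * adjTransposition a := by
      rw [wordPerm, hwp, mul_assoc _ (adjTransposition b), adj_mul_self, mul_one]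
    have e2 : wordPerm (a :: w) = π * adjTransposition b := by
      rw [wordPerm, hwp, mul_assoc π, adj_comm hc, ← mul_assoc,
        mul_assoc _ (adjTransposition a), adj_mul_self, mul_one]
    refine ⟨b :: w, a :: w, ?_, ?_, ?_, ?_, ?_⟩
    · rw [reduced_cons, reduced_cons, e1]
      refine ⟨ha, ⟨hb, hw, ?_⟩, hlt⟩
      simp only [hwp, Equiv.Perm.mul_apply, adj_apply] at hlt' ⊢
      grind
    · rw [wordPerm, e1, mul_assoc, adj_mul_self, mul_one]
    · rw [reduced_cons, reduced_cons, e2]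
      refine ⟨hb, ⟨ha, hw, ?_⟩, hlt'⟩
      simp only [hwp, Equiv.Perm.mul_apply, adj_apply] at hlt ⊢
      grind
    · rw [wordPerm, e2, mul_assoc, adj_mul_self, mul_one]
    · simp only [List.map_cons, List.prod_cons, ← mul_assoc, hd.comm a b hc]
  · obtain rfl : b = a + 1 := by omega
    obtain ⟨w, hw, hwp⟩ := (((hπ.mul hadj).mul hadj').mul hadj).exists_reduced
    have e1 : wordPerm (a :: w) = π * adjTransposition a * adjTransposition (a + 1) := by
      rw [wordPerm, hwp, mul_assoc _ (adjTransposition a), adj_mul_self, mul_one]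
    have e2 : wordPerm ((a + 1) :: a :: w) = π * adjTransposition a := by
      rw [wordPerm, e1, mul_assoc _ (adjTransposition (a + 1)), adj_mul_self, mul_one]
    have hwp' : wordPerm w = π * adjTransposition (a + 1) * adjTransposition a *
        adjTransposition (a + 1) := by
      rw [hwp, mul_assoc π, mul_assoc π, adj_braid, ← mul_assoc, ← mul_assoc]
    have e3 : wordPerm ((a + 1) :: w) = π * adjTransposition (a + 1) * adjTransposition a := by
      rw [wordPerm, hwp', mul_assoc _ (adjTransposition (a + 1)), adj_mul_self, mul_one]
    have e4 : wordPerm (a :: (a + 1) :: w) = π * adjTransposition (a + 1) := by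
      rw [wordPerm, e3, mul_assoc _ (adjTransposition a), adj_mul_self, mul_one]
    simp only [Equiv.Perm.mul_apply, adj_apply] at hlt hlt'
    refine ⟨(a + 1) :: a :: w, a :: (a + 1) :: w, ?_, ?_, ?_, ?_, ?_⟩
    · rw [reduced_cons, reduced_cons, reduced_cons, e1, e2, hwp]
      refine ⟨ha, ⟨hb, ⟨ha, hw, ?_⟩, ?_⟩, ?_⟩ <;>
        simp only [Equiv.Perm.mul_apply, adj_apply] <;> grind
    · rw [wordPerm, e2, mul_assoc, adj_mul_self, mul_one]
    · rw [reduced_cons, reduced_cons, reduced_cons, e3, e4, hwp']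
      refine ⟨hb, ⟨ha, ⟨hb, hw, ?_⟩, ?_⟩, ?_⟩ <;>
        simp only [Equiv.Perm.mul_apply, adj_apply] <;> grind
    · rw [wordPerm, e4, mul_assoc, adj_mul_self, mul_one]
    · simp only [List.map_cons, List.prod_cons, ← mul_assoc, hd.braid a]

theorem IsNilCoxeter.prod_eq (hd : IsNilCoxeter d) {n : ℕ} {u v : List ℕ} (hu : Reduced n u)
    (hv : Reduced n v) (h : wordPerm u = wordPerm v) : (u.map d).prod = (v.map d).prod := by
  induction hN : u.length generalizing u v with
  | zero =>
    have : v.length = 0 := by rw [← hv.2, ← h, hu.2, hN]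
    rw [List.length_eq_zero_iff.1 hN, List.length_eq_zero_iff.1 this]
  | succ N ih =>
    have hNv : v.length = N + 1 := by rw [← hv.2, ← h, hu.2, hN]
    have same : ∀ (a : ℕ) (u v : List ℕ), Reduced n (a :: u) → Reduced n (a :: v) →
        wordPerm (a :: u) = wordPerm (a :: v) → u.length = N →
        ((a :: u).map d).prod = ((a :: v).map d).prod := by
      intro a u v hu hv h hl
      rw [List.map_cons, List.map_cons, List.prod_cons, List.prod_cons,
        ih (reduced_cons.1 hu).2.1 (reduced_cons.1 hv).2.1 (mul_right_cancel h) hl]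
    have diff : ∀ (a b : ℕ) (u v : List ℕ), a < b → Reduced n (a :: u) → Reduced n (b :: v) →
        wordPerm (a :: u) = wordPerm (b :: v) → u.length = N → v.length = N →
        ((a :: u).map d).prod = ((b :: v).map d).prod := by
      intro a b u v hab hu hv h hl hl'
      obtain ⟨u', v', hu', hpu, hv', hpv, he⟩ := hd.exists_common hab hu hv h
      rw [same a u u' hu hu' hpu.symm hl, he, same b v v' hv hv' (hpv.trans h).symm hl']
    cases u with
    | nil => simp at hN
    | cons a u =>
      cases v with
      | nil => simp at hNv
      | cons b v =>
        simp only [List.length_cons, add_left_inj] at hN hNv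
        rcases lt_trichotomy a b with hab | rfl | hab
        · exact diff a b u v hab hu hv h hN hNv
        · exact same a u v hu hv h hN
        · exact (diff b a v u hab hv hu h.symm hNv hN).symm

theorem IsNilCoxeter.prod_eq_zero (hd : IsNilCoxeter d) {n : ℕ} {u : List ℕ} (hu : IsWord n u)
    (h : ¬ Reduced n u) : (u.map d).prod = 0 := by
  induction u with
  | nil => exact absurd ⟨hu, by simp [wordPerm, inv_one]⟩ h
  | cons a u ih =>
    obtain ⟨ha, hw⟩ := isWord_cons.1 hu
    rw [List.map_cons, List.prod_cons]
    by_cases hr : Reduced n u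
    · have hgt : wordPerm u (a + 1) < wordPerm u a :=
        (adj_lt_or_gt _ a).resolve_left fun hlt => h (reduced_cons.2 ⟨ha, hr, hlt⟩)
      obtain ⟨v, hv, hvp⟩ := (hw.fixesOutside.mul (fixesOutside_adj ha.1 ha.2)).exists_reduced
      have hav : wordPerm (a :: v) = wordPerm u := by
        rw [wordPerm, hvp, mul_assoc, adj_mul_self, mul_one]
      have hred : Reduced n (a :: v) :=
        reduced_cons.2 ⟨ha, hv, by simpa [hvp, adj_apply] using hgt⟩
      rw [hd.prod_eq hr hred hav.symm, List.map_cons, List.prod_cons, ← mul_assoc, hd.sq,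
        zero_mul]
    · rw [ih hw hr, mul_zero]

end NilCoxeter

/-! ### Divided differences -/

/-- Sequences of pairwise distinct rational numbers. -/
abbrev Points : Type := {x : ℕ → ℚ // Function.Injective x}

/-- Exchange the entries in positions `a` and `a + 1`. -/
def Points.act (x : Points) (a : ℕ) : Points :=
  ⟨x.1 ∘ adjTransposition a, x.2.comp (adjTransposition a).injective⟩

theorem Points.act_apply (x : Points) (a i : ℕ) :
    (x.act a).1 i = x.1 (if i = a then a + 1 else if i = a + 1 then a else i) := by
  rw [← adj_apply]; rfl

theorem Points.act_act (x : Points) (a : ℕ) : (x.act a).act a = x :=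
  Subtype.ext <| funext fun i => congrArg x.1 (adj_adj a i)

theorem Points.act_comm (x : Points) {a b : ℕ} (h : a + 2 ≤ b) :
    (x.act a).act b = (x.act b).act a :=
  Subtype.ext <| funext fun i => congrArg x.1 (DFunLike.congr_fun (adj_comm h) i)

theorem Points.act_braid (x : Points) (a : ℕ) :
    ((x.act a).act (a + 1)).act a = ((x.act (a + 1)).act a).act (a + 1) :=
  Subtype.ext <| funext fun i => congrArg x.1 (DFunLike.congr_fun (adj_braid a) i)

theorem Points.sub_ne_zero (x : Points) {i j : ℕ} (h : i ≠ j) : x.1 i - x.1 j ≠ 0 :=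
  _root_.sub_ne_zero.2 (x.2.ne h)

/-- The divided difference operator exchanging `a` and `a + 1`. -/
def dividedDiff (a : ℕ) : Module.End ℚ (Points → ℚ) where
  toFun F x := (F x - F (x.act a)) / (x.1 a - x.1 (a + 1))
  map_add' F G := by ext x; simp only [Pi.add_apply]; ring
  map_smul' c F := by ext x; simp only [Pi.smul_apply, smul_eq_mul, RingHom.id_apply]; ring

theorem dividedDiff_apply (a : ℕ) (F : Points → ℚ) (x : Points) :
    dividedDiff a F x = (F x - F (x.act a)) / (x.1 a - x.1 (a + 1)) := rfl

theorem isNilCoxeter_dividedDiff : IsNilCoxeter dividedDiff where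
  sq a := by
    ext F x
    have h := x.sub_ne_zero (show a ≠ a + 1 by omega)
    have h' := x.sub_ne_zero (show a + 1 ≠ a by omega)
    simp only [Module.End.mul_apply, dividedDiff_apply, Points.act_act, Points.act_apply,
      if_true, if_neg (show a + 1 ≠ a by omega), LinearMap.zero_apply, Pi.zero_apply]
    field_simp
    ring
  comm a b h := by
    ext F x
    simp only [Module.End.mul_apply, dividedDiff_apply, Points.act_apply, x.act_comm h,
      if_neg (show a ≠ b by omega), if_neg (show a + 1 ≠ b by omega),
      if_neg (show a ≠ b + 1 by omega), if_neg (show a + 1 ≠ b + 1 by omega),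
      if_neg (show b ≠ a by omega), if_neg (show b + 1 ≠ a by omega),
      if_neg (show b ≠ a + 1 by omega), if_neg (show b + 1 ≠ a + 1 by omega)]
    ring
  braid a := by
    ext F x
    have h1 := x.sub_ne_zero (show a ≠ a + 1 by omega)
    have h2 := x.sub_ne_zero (show a + 1 ≠ a + 2 by omega)
    have h3 := x.sub_ne_zero (show a ≠ a + 2 by omega)
    have h1' := x.sub_ne_zero (show a + 1 ≠ a by omega)
    have h2' := x.sub_ne_zero (show a + 2 ≠ a + 1 by omega)
    have e1 : a + 1 ≠ a := by omega
    have e2 : a + 1 + 1 ≠ a := by omega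
    have e3 : a + 1 + 1 ≠ a + 1 := by omega
    have e4 : a ≠ a + 1 := by omega
    have e5 : a ≠ a + 1 + 1 := by omega
    simp only [Module.End.mul_apply, dividedDiff_apply, Points.act_apply, Points.act_act,
      x.act_braid, if_true, if_neg e1, if_neg e2, if_neg e3, if_neg e4, if_neg e5]
    field_simp
    ring

/-! ### Counting reduced words of the long word -/

/-- Prepend a letter to a word. -/
def consEmbedding : ℕ × List ℕ ↪ List ℕ where
  toFun p := p.1 :: p.2
  inj' p q h := by simpa [Prod.ext_iff] using h

theorem consEmbedding_apply (p : ℕ × List ℕ) : consEmbedding p = p.1 :: p.2 := rfl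

/-- The words of length `N` in the letters `1, …, n - 1`. -/
def words (n : ℕ) : ℕ → Finset (List ℕ)
  | 0 => {[]}
  | N + 1 => (Icc 1 (n - 1) ×ˢ words n N).map consEmbedding

theorem mem_words {n N : ℕ} {w : List ℕ} : w ∈ words n N ↔ w.length = N ∧ IsWord n w := by
  induction N generalizing w with
  | zero =>
    rw [words, mem_singleton, List.length_eq_zero_iff]
    exact ⟨fun h => ⟨h, by simp [h, IsWord]⟩, And.left⟩
  | succ N ih =>
    simp only [words, mem_map, mem_product, mem_Icc, ih,
      consEmbedding_apply, Prod.exists]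
    constructor
    · rintro ⟨a, u, ⟨ha, hl, hu⟩, rfl⟩
      exact ⟨by simp [hl], isWord_cons.2 ⟨by omega, hu⟩⟩
    · rintro ⟨hl, hw⟩
      cases w with
      | nil => simp at hl
      | cons a u =>
        rw [isWord_cons] at hw
        exact ⟨a, u, ⟨by omega, by simpa using hl, hw.2⟩, rfl⟩

theorem sum_pow_eq_sum_words {G : Type*} [Semiring G] (d : ℕ → G) (n N : ℕ) :
    (∑ a ∈ Icc 1 (n - 1), d a) ^ N = ∑ w ∈ words n N, (w.map d).prod := by
  induction N with
  | zero => simp [words]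
  | succ N ih =>
    rw [pow_succ', ih, words, sum_map, sum_product, sum_mul_sum]
    simp [consEmbedding_apply]

open Classical in
/-- The reduced words of the long word. -/
noncomputable def longReduced (n : ℕ) : Finset (List ℕ) :=
  {w ∈ words n (n.choose 2) | wordPerm w = longWord n}

/-- The reduced words of the long word with first letter `k`. -/
noncomputable def longReducedHead (n k : ℕ) : Finset (List ℕ) :=
  {w ∈ longReduced n | w.head? = some k}

open Classical in
theorem mem_longReduced {n : ℕ} {w : List ℕ} :
    w ∈ longReduced n ↔ Reduced n w ∧ wordPerm w = longWord n := by
  rw [longReduced, mem_filter, mem_words, Reduced]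
  constructor
  · rintro ⟨⟨hl, hw⟩, h⟩
    exact ⟨⟨hw, by rw [h, inv_longWord, hl]⟩, h⟩
  · rintro ⟨⟨hw, hl⟩, h⟩
    exact ⟨⟨by rw [← hl, h, inv_longWord], hw⟩, h⟩

open Classical in
theorem mem_longReduced_iff {n : ℕ} {w : List ℕ} : w ∈ longReduced n ↔ IsReducedWord n w := by
  rw [longReduced, mem_filter, mem_words, IsReducedWord, wordPerm_eq, inv_eq_iff_eq_inv,
    longWord_inv, and_assoc]
  have : IsWord n w ↔ ∀ a ∈ w, 1 ≤ a ∧ a ≤ n - 1 :=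
    forall₂_congr fun a _ => by omega
  rw [this]

theorem longReduced_nonempty (n : ℕ) : (longReduced n).Nonempty := by
  obtain ⟨w, hw⟩ := (fixesOutside_longWord n).exists_reduced
  exact ⟨w, mem_longReduced.2 hw⟩

open Classical in
theorem longReduced_subset_words (n : ℕ) : longReduced n ⊆ words n (n.choose 2) :=
  filter_subset _ _

theorem mem_longReduced_of_reduced {n : ℕ} {w : List ℕ} (hw : w ∈ words n (n.choose 2))
    (h : Reduced n w) : w ∈ longReduced n := by
  rw [mem_words] at hw
  exact mem_longReduced.2 ⟨h, eq_longWord_of_inv hw.2.fixesOutside (h.2.trans hw.1)⟩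

theorem IsNilCoxeter.exists_sum_pow {G : Type*} [Semiring G] {d : ℕ → G} (hd : IsNilCoxeter d)
    {n : ℕ} (hn : 2 ≤ n) :
    ∃ T : G, (∑ a ∈ Icc 1 (n - 1), d a) ^ n.choose 2 = #(longReduced n) • T ∧
      ∀ k ∈ Icc 1 (n - 1), d k * (∑ a ∈ Icc 1 (n - 1), d a) ^ (n.choose 2 - 1) =
        #(longReducedHead n k) • T := by
  obtain ⟨v, hv⟩ := longReduced_nonempty n
  have hprod : ∀ w ∈ longReduced n, (w.map d).prod = (v.map d).prod := fun w hw => by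
    rw [mem_longReduced] at hv hw
    exact hd.prod_eq hw.1 hv.1 (hw.2.trans hv.2.symm)
  refine ⟨(v.map d).prod, ?_, fun k hk => ?_⟩
  · rw [sum_pow_eq_sum_words, ← sum_const, ← sum_congr rfl hprod]
    refine (sum_subset (longReduced_subset_words n) fun w hw hw' => ?_).symm
    exact hd.prod_eq_zero (mem_words.1 hw).2 fun h => hw' (mem_longReduced_of_reduced hw h)
  · have hm : n.choose 2 - 1 + 1 = n.choose 2 :=
      Nat.sub_add_cancel (Nat.choose_pos hn)
    rw [mem_Icc] at hk
    rw [sum_pow_eq_sum_words, mul_sum, ← sum_const,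
      ← sum_congr rfl fun w (hw : w ∈ longReducedHead n k) => hprod w (mem_filter.1 hw).1]
    have hsub : longReducedHead n k ⊆ (words n (n.choose 2 - 1)).map
        ⟨List.cons k, List.cons_injective⟩ := by
      intro w hw
      rw [longReducedHead, mem_filter, mem_longReduced_iff, IsReducedWord] at hw
      obtain ⟨⟨hl, hw, -⟩, hh⟩ := hw
      obtain ⟨u, rfl⟩ : ∃ u, w = k :: u := by
        cases w with
        | nil => simp at hh
        | cons b u => exact ⟨u, by simpa using hh⟩
      rw [mem_map]
      refine ⟨u, mem_words.2 ⟨?_, fun a ha => ?_⟩, rfl⟩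
      · rw [← hl, List.length_cons]
        rfl
      · have := hw a (List.mem_cons_of_mem _ ha)
        omega
    rw [sum_subset hsub, sum_map]
    · simp
    · intro w hw hw'
      rw [mem_map] at hw
      obtain ⟨u, hu, rfl⟩ := hw
      rw [mem_words] at hu
      have hkw : IsWord n (k :: u) := isWord_cons.2 ⟨by omega, hu.2⟩
      refine hd.prod_eq_zero hkw fun h => hw' (mem_filter.2 ⟨mem_longReduced_of_reduced ?_ h, rfl⟩)
      exact mem_words.2 ⟨by simp [hu.1, hm], hkw⟩

/-! ### The row polynomials -/

open Polynomial

/-- The `j`-th entry is the complete homogeneous polynomial of degree `l - j` in `x 1, …, x i`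
and an exponential alphabet scaled by the indeterminate. -/
noncomputable def rowPoly (x : ℕ → ℚ) : ℕ → ℕ → ℕ → ℚ[X]
  | 0, l, j => if j ≤ l then monomial (l - j) ((l - j).factorial : ℚ)⁻¹ else 0
  | _ + 1, 0, j => if j ≤ 0 then 1 else 0
  | i + 1, l + 1, j => rowPoly x i (l + 1) j + C (x (i + 1)) * rowPoly x (i + 1) l j

theorem rowPoly_succ_succ (x : ℕ → ℚ) (i l j : ℕ) : rowPoly x (i + 1) (l + 1) j =
    rowPoly x i (l + 1) j + C (x (i + 1)) * rowPoly x (i + 1) l j := by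
  rw [rowPoly]

theorem rowPoly_zero_right (x : ℕ → ℚ) (i j : ℕ) :
    rowPoly x i 0 j = if j ≤ 0 then 1 else 0 := by
  cases i with
  | zero =>
    rw [rowPoly]
    refine if_congr Iff.rfl ?_ rfl
    simp
  | succ i => rw [rowPoly]

theorem derivative_rowPoly_zero (x : ℕ → ℚ) (i j : ℕ) : derivative (rowPoly x i 0 j) = 0 := by
  rw [rowPoly_zero_right]
  split_ifs <;> simp

theorem derivative_rowPoly_succ (x : ℕ → ℚ) (i l j : ℕ) :
    derivative (rowPoly x i (l + 1) j) = rowPoly x i l j := by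
  induction i generalizing l with
  | zero =>
    rw [rowPoly, rowPoly]
    rcases lt_trichotomy j (l + 1) with h | rfl | h
    · rw [if_pos (by omega), if_pos (by omega), derivative_monomial,
        show l + 1 - j = l - j + 1 by omega, Nat.factorial_succ]
      congr 1
      push_cast
      field_simp
    · simp
    · rw [if_neg (by omega), if_neg (by omega), derivative_zero]
  | succ i ih =>
    induction l with
    | zero =>
      rw [rowPoly_succ_succ, derivative_add, ih, derivative_C_mul, derivative_rowPoly_zero,
        mul_zero,
        add_zero, rowPoly_zero_right, rowPoly_zero_right]
    | succ l ihl =>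
      rw [rowPoly_succ_succ, derivative_add, ih, derivative_C_mul, ihl, ← rowPoly_succ_succ]

theorem coeff_rowPoly_of_lt (x : ℕ → ℚ) {i l j d : ℕ} (h : l < j + d) :
    (rowPoly x i l j).coeff d = 0 := by
  induction i generalizing l with
  | zero =>
    rw [rowPoly]
    split_ifs
    · rw [coeff_monomial, if_neg (by omega)]
    · exact coeff_zero d
  | succ i ih =>
    induction l with
    | zero =>
      rw [rowPoly]
      split_ifs
      · rw [coeff_one, if_neg (by omega)]
      · exact coeff_zero d
    | succ l ihl => rw [rowPoly, coeff_add, coeff_C_mul, ih h, ihl (by omega), mul_zero, add_zero]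

theorem coeff_rowPoly_top (x : ℕ → ℚ) {i l j d : ℕ} (h : l = j + d) :
    (rowPoly x i l j).coeff d = (d.factorial : ℚ)⁻¹ := by
  induction i generalizing l with
  | zero => rw [rowPoly, if_pos (by omega), coeff_monomial, if_pos (by omega),
      show l - j = d by omega]
  | succ i ih =>
    cases l with
    | zero =>
      obtain ⟨rfl, rfl⟩ : j = 0 ∧ d = 0 := by omega
      simp [rowPoly]
    | succ l =>
      rw [rowPoly, coeff_add, coeff_C_mul, ih h, coeff_rowPoly_of_lt x (by omega), mul_zero,
        add_zero]

theorem rowPoly_act_of_lt (x : Points) {a i : ℕ} (h : i < a) (l j : ℕ) :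
    rowPoly (x.act a).1 i l j = rowPoly x.1 i l j := by
  induction i generalizing l with
  | zero => rw [rowPoly, rowPoly]
  | succ i ih =>
    induction l with
    | zero => rw [rowPoly, rowPoly]
    | succ l ihl =>
      rw [rowPoly, rowPoly, ih (by omega), ihl, Points.act_apply, if_neg (by omega),
        if_neg (by omega)]

theorem rowPoly_act (x : Points) {a : ℕ} (ha : 1 ≤ a) (l j : ℕ) :
    rowPoly (x.act a).1 a (l + 1) j - rowPoly x.1 a (l + 1) j =
        C (x.1 (a + 1) - x.1 a) * rowPoly x.1 (a + 1) l j ∧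
      rowPoly (x.act a).1 (a + 1) l j = rowPoly x.1 (a + 1) l j := by
  obtain ⟨b, rfl⟩ : ∃ b, a = b + 1 := ⟨a - 1, by omega⟩
  have hb : ∀ l, rowPoly (x.act (b + 1)).1 b l j = rowPoly x.1 b l j := fun l =>
    rowPoly_act_of_lt x (by omega) l j
  have e1 : (x.act (b + 1)).1 (b + 1) = x.1 (b + 1 + 1) := by simp [Points.act_apply]
  have e2 : (x.act (b + 1)).1 (b + 1 + 1) = x.1 (b + 1) := by simp [Points.act_apply]
  induction l with
  | zero =>
    refine ⟨?_, by rw [rowPoly_zero_right, rowPoly_zero_right]⟩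
    rw [rowPoly_succ_succ, rowPoly_succ_succ, hb, e1]
    simp only [rowPoly_zero_right, C_sub]
    ring
  | succ l ih =>
    have key : rowPoly (x.act (b + 1)).1 (b + 1) (l + 1 + 1) j
        - rowPoly x.1 (b + 1) (l + 1 + 1) j
        = C (x.1 (b + 1 + 1) - x.1 (b + 1)) * rowPoly x.1 (b + 1 + 1) (l + 1) j := by
      rw [rowPoly_succ_succ, rowPoly_succ_succ _ b (l + 1), rowPoly_succ_succ _ (b + 1) l, hb, e1]
      simp only [C_sub] at ih ⊢
      linear_combination C (x.1 (b + 1 + 1)) * ih.1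
    refine ⟨key, ?_⟩
    rw [rowPoly_succ_succ, rowPoly_succ_succ _ (b + 1) l, ih.2, e2]
    have := ih.1
    simp only [C_sub] at this
    linear_combination this

theorem rowPoly_act_of_ne (x : Points) {a i : ℕ} (ha : 1 ≤ a) (h : i ≠ a) (l j : ℕ) :
    rowPoly (x.act a).1 i l j = rowPoly x.1 i l j := by
  rcases h.lt_or_gt with h | h
  · exact rowPoly_act_of_lt x h l j
  induction i, h using Nat.le_induction generalizing l with
  | base => exact (rowPoly_act x ha l j).2
  | succ i hi ih =>
    induction l with
    | zero => rw [rowPoly, rowPoly]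
    | succ l ihl =>
      rw [rowPoly, rowPoly, ih (by omega), ihl, Points.act_apply, if_neg (by omega),
        if_neg (by omega)]

theorem derivative_det {n : ℕ} (M : Matrix (Fin n) (Fin n) ℚ[X]) :
    derivative M.det = ∑ i, (M.updateRow i fun j => derivative (M i j)).det := by
  simp only [← Matrix.det_transpose M, ← Matrix.det_transpose (Matrix.updateRow _ _ _),
    Matrix.det_apply, derivative_sum]
  rw [sum_comm]
  refine sum_congr rfl fun σ _ => ?_
  rw [← smul_sum, derivative_smul, derivative_prod_finset]
  congr 1
  refine sum_congr rfl fun i _ => ?_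
  rw [← mul_prod_erase univ _ (mem_univ i), mul_comm]
  simp only [Matrix.transpose_apply, Matrix.updateRow_self]
  congr 1
  refine prod_congr rfl fun j hj => ?_
  rw [Matrix.updateRow_ne (ne_of_mem_erase hj)]

theorem natDegree_prod_le_and_coeff {ι : Type*} (s : Finset ι) (f : ι → ℚ[X]) (e : ι → ℕ)
    (h : ∀ i ∈ s, (f i).natDegree ≤ e i) :
    (∏ i ∈ s, f i).natDegree ≤ ∑ i ∈ s, e i ∧
      (∏ i ∈ s, f i).coeff (∑ i ∈ s, e i) = ∏ i ∈ s, (f i).coeff (e i) := by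
  classical
  induction s using Finset.induction_on with
  | empty => simp
  | insert a s ha ih =>
    obtain ⟨h1, h2⟩ := ih fun i hi => h i (mem_insert_of_mem hi)
    have h3 := h a (mem_insert_self a s)
    rw [prod_insert ha, sum_insert ha, prod_insert ha, ← h2]
    exact ⟨natDegree_mul_le_of_le h3 h1, coeff_mul_add_eq_of_natDegree_le h3 h1⟩

theorem coeff_det {n : ℕ} (M : Matrix (Fin n) (Fin n) ℚ[X]) (e : Fin n → ℕ)
    (h : ∀ i j, (M i j).natDegree ≤ e i) :
    M.det.coeff (∑ i, e i) = (Matrix.of fun i j => (M i j).coeff (e i)).det := by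
  rw [← Matrix.det_transpose, ← Matrix.det_transpose (Matrix.of _), Matrix.det_apply,
    Matrix.det_apply, finsetSum_coeff]
  refine sum_congr rfl fun σ _ => ?_
  rw [coeff_smul]
  congr 1
  exact (natDegree_prod_le_and_coeff univ _ e fun i _ => h i (σ i)).2

/-- The determinant whose rows are given by `rowPoly` with exponents `l`. -/
noncomputable def rowDet {n : ℕ} (x : ℕ → ℚ) (l : Fin n → ℕ) : ℚ[X] :=
  (Matrix.of fun i j : Fin n => rowPoly x (i + 1) (l i) j).det

theorem det_factorial_inv {n : ℕ} (l : Fin n → ℕ) :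
    (Matrix.of fun i j : Fin n => if (j : ℕ) ≤ l i then ((l i - j).factorial : ℚ)⁻¹ else 0).det =
      (∏ i, ((l i).factorial : ℚ)⁻¹) * (Matrix.vandermonde fun i => (l i : ℚ)).det := by
  rw [Matrix.det_eval_matrixOfPolynomials_eq_det_vandermonde _
    (fun j : Fin n => descPochhammer ℚ j) (fun j => descPochhammer_natDegree ℚ j)
    (fun j => monic_descPochhammer ℚ j), ← Matrix.det_mul_column]
  congr 1
  ext i j
  simp only [Matrix.of_apply, descPochhammer_eval_eq_descFactorial]
  split_ifs with h
  · rw [← Nat.factorial_mul_descFactorial h]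
    have := Nat.factorial_ne_zero (l i - j)
    have : (l i).descFactorial j ≠ 0 := Nat.descFactorial_eq_zero_iff_lt.not.2 (by omega)
    push_cast
    field_simp
  · rw [Nat.descFactorial_eq_zero_iff_lt.2 (by omega)]
    simp

theorem coeff_rowDet {n : ℕ} (x : ℕ → ℚ) (l : Fin n → ℕ) {d : ℕ}
    (hd : d + ∑ j : Fin n, (j : ℕ) = ∑ i, l i) :
    (rowDet x l).coeff d =
      (∏ i, ((l i).factorial : ℚ)⁻¹) * (Matrix.vandermonde fun i => (l i : ℚ)).det := by
  have h1 := Matrix.det_mul_row (fun j : Fin n => (X : ℚ[X]) ^ (j : ℕ))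
    (Matrix.of fun i j : Fin n => rowPoly x (i + 1) (l i) j)
  have h2 := coeff_det (Matrix.of fun i j : Fin n => X ^ (j : ℕ) * rowPoly x (i + 1) (l i) j) l
    fun i j => by
      rw [natDegree_le_iff_coeff_eq_zero]
      intro N hN
      rw [Matrix.of_apply, coeff_X_pow_mul']
      split_ifs
      · exact coeff_rowPoly_of_lt x (by omega)
      · rfl
  rw [← det_factorial_inv]
  simp only [Matrix.of_apply] at h1
  rw [h1, prod_pow_eq_pow_sum, ← hd, coeff_X_pow_mul] at h2
  rw [rowDet, h2]
  congr 1
  ext i j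
  simp only [Matrix.of_apply]
  rw [coeff_X_pow_mul']
  split_ifs with h
  · exact coeff_rowPoly_top x (by omega)
  · rfl

theorem det_vandermonde_update {n : ℕ} {v : Fin n → ℚ} (hv : Function.Injective v) (k : Fin n)
    (c : ℚ) : (Matrix.vandermonde (Function.update v k c)).det =
      (∏ j ∈ univ.erase k, ((c - v j) / (v k - v j))) * (Matrix.vandermonde v).det := by
  have hrow : Matrix.vandermonde (Function.update v k c) =
      (Matrix.vandermonde v).updateRow k
        (∑ i, (Lagrange.basis univ v i).eval c • Matrix.vandermonde v i) := by
    ext i j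
    by_cases hi : i = k
    · subst hi
      rw [Matrix.updateRow_self, Matrix.vandermonde_apply, Function.update_self, Finset.sum_apply]
      have hX := Lagrange.eq_interpolate (s := univ) (f := (X : ℚ[X]) ^ (j : ℕ)) hv.injOn
        (by rw [degree_X_pow, card_univ, Fintype.card_fin]; exact_mod_cast j.2)
      have := congrArg (eval c) hX
      rw [Lagrange.interpolate_apply, eval_finsetSum, eval_pow, eval_X] at this
      rw [this]
      refine sum_congr rfl fun i _ => ?_
      simp [Matrix.vandermonde_apply, mul_comm]
    · rw [Matrix.updateRow_ne hi, Matrix.vandermonde_apply, Matrix.vandermonde_apply,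
        Function.update_of_ne hi]
  rw [hrow, Matrix.det_updateRow_sum, smul_eq_mul, Lagrange.basis, eval_prod]
  congr 1
  refine prod_congr rfl fun j _ => ?_
  rw [Lagrange.basisDivisor, eval_mul, eval_C, eval_sub, eval_X, eval_C, div_eq_inv_mul]

theorem derivative_rowDet {n : ℕ} (x : ℕ → ℚ) (l : Fin n → ℕ) :
    derivative (rowDet x l) =
      ∑ i, if l i = 0 then 0 else rowDet x (Function.update l i (l i - 1)) := by
  rw [rowDet, derivative_det]
  refine sum_congr rfl fun i _ => ?_
  split_ifs with h
  · refine Matrix.det_eq_zero_of_row_eq_zero i fun j => ?_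
    rw [Matrix.updateRow_self, Matrix.of_apply, h, derivative_rowPoly_zero]
  · rw [rowDet]
    congr 1
    ext1 i' j
    by_cases hi : i' = i
    · subst hi
      obtain ⟨b, hb⟩ := Nat.exists_eq_succ_of_ne_zero h
      rw [Matrix.updateRow_self, Matrix.of_apply, Matrix.of_apply, Function.update_self, hb,
        Nat.succ_eq_add_one, derivative_rowPoly_succ, Nat.add_sub_cancel]
    · rw [Matrix.updateRow_ne hi, Matrix.of_apply, Matrix.of_apply, Function.update_of_ne hi]

theorem rowDet_sub_act {n : ℕ} (x : Points) (l : Fin n → ℕ) {k k' : Fin n}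
    (hk : (k' : ℕ) = k + 1) (hl : l k = l k' + 2) :
    rowDet x.1 l - rowDet (x.act (k + 1)).1 l =
      C (x.1 (k + 1) - x.1 (k + 1 + 1)) * rowDet x.1 (Function.update l k (l k - 1)) := by
  set M : Matrix (Fin n) (Fin n) ℚ[X] := Matrix.of fun i j => rowPoly x.1 (i + 1) (l i) j with hM
  have hne : k ≠ k' := fun h => by rw [h] at hk; omega
  have h0 (u : Fin n → ℚ[X]) (c : ℚ[X]) :
      (M.updateRow k (u + c • M k')).det = (M.updateRow k u).det := by
    rw [Matrix.det_updateRow_add, Matrix.det_updateRow_smul, Matrix.det_updateRow_eq_zero hne.symm,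
      mul_zero, add_zero]
  have h1 : rowDet (x.act (k + 1)).1 l =
      (M.updateRow k fun j => rowPoly (x.act (k + 1)).1 (k + 1) (l k) j).det := by
    rw [rowDet]
    congr 1
    ext1 i j
    by_cases hi : i = k
    · subst hi
      rw [Matrix.updateRow_self, Matrix.of_apply]
    · rw [Matrix.updateRow_ne hi, Matrix.of_apply, hM, Matrix.of_apply,
        rowPoly_act_of_ne x (by omega) fun h => hi (Fin.ext (by omega))]
  have h2 : rowDet x.1 l = (M.updateRow k fun j => rowPoly x.1 (k + 1) (l k) j).det := by
    rw [rowDet, ← hM]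
    congr 1
    exact (Matrix.updateRow_eq_self M k).symm
  have h3 : rowDet x.1 (Function.update l k (l k - 1)) =
      (M.updateRow k fun j => rowPoly x.1 (k + 1) (l k - 1) j).det := by
    rw [rowDet]
    congr 1
    ext1 i j
    by_cases hi : i = k
    · subst hi
      rw [Matrix.updateRow_self, Matrix.of_apply, Function.update_self]
    · rw [Matrix.updateRow_ne hi, Matrix.of_apply, hM, Matrix.of_apply, Function.update_of_ne hi]
  have h4 : (fun j : Fin n => rowPoly x.1 (k + 1) (l k) j) =
      (fun j : Fin n => rowPoly (x.act (k + 1)).1 (k + 1) (l k) j) +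
        C (x.1 (k + 1) - x.1 (k + 1 + 1)) •
          ((fun j : Fin n => rowPoly x.1 (k + 1) (l k - 1) j) + C (x.1 (k + 1 + 1)) • M k') := by
    ext1 j
    have e1 := (rowPoly_act x (a := k + 1) (by omega) (l k' + 1) j).1
    have e2 := rowPoly_succ_succ x.1 (k + 1) (l k') j
    simp only [Pi.add_apply, Pi.smul_apply, smul_eq_mul, hM, Matrix.of_apply, hk, hl,
      show l k' + 2 - 1 = l k' + 1 by omega]
    rw [e2] at e1
    simp only [C_sub] at e1 ⊢
    linear_combination -e1
  rw [h1, h2, h3, h4, Matrix.det_updateRow_add, Matrix.det_updateRow_smul, h0]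
  ring

/-- The doubled staircase exponents. -/
def staircase (N : ℕ) (i : Fin (N + 1)) : ℕ := 2 * (N - i)

/-- The doubled staircase with the `k`-th exponent lowered by one. -/
def loweredStaircase (N : ℕ) (k : Fin N) : Fin (N + 1) → ℕ :=
  Function.update (staircase N) k.castSucc (staircase N k.castSucc - 1)

theorem dividedDiff_coeff_rowDet {N : ℕ} (k : Fin N) (d : ℕ) :
    dividedDiff (k + 1) (fun x => (rowDet x.1 (staircase N)).coeff d) =
      fun x => (rowDet x.1 (loweredStaircase N k)).coeff d := by
  ext x
  have h := congrArg (fun p => coeff p d) (rowDet_sub_act x (staircase N) (k := k.castSucc)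
    (k' := k.succ) (by simp) (by simp [staircase]; omega))
  simp only [coeff_sub, coeff_C_mul, Fin.val_castSucc] at h
  rw [dividedDiff_apply, h, mul_div_cancel_left₀ _ (x.sub_ne_zero (by omega)), loweredStaircase]

theorem derivative_rowDet_staircase {N : ℕ} (x : ℕ → ℚ) :
    derivative (rowDet x (staircase N)) = ∑ k : Fin N, rowDet x (loweredStaircase N k) := by
  rw [derivative_rowDet, Fin.sum_univ_castSucc, if_pos (by simp [staircase]), add_zero]
  refine sum_congr rfl fun k _ => ?_
  rw [if_neg (by simp [staircase]; omega), loweredStaircase]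

theorem sum_dividedDiff_coeff_rowDet (N d : ℕ) :
    (∑ a ∈ Icc 1 N, dividedDiff a) (fun x => (rowDet x.1 (staircase N)).coeff d) =
      ((d : ℚ) + 1) • fun x => (rowDet x.1 (staircase N)).coeff (d + 1) := by
  have h : ∑ a ∈ Icc 1 N, dividedDiff a = ∑ k : Fin N, dividedDiff (k + 1) := by
    rw [Fin.sum_univ_eq_sum_range (fun k => dividedDiff (k + 1)), range_eq_Ico,
      sum_Ico_add' dividedDiff 0 N 1, ← Finset.Ico_succ_right_eq_Icc]
    rfl
  ext x
  rw [h, LinearMap.sum_apply]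
  simp only [dividedDiff_coeff_rowDet]
  rw [Finset.sum_apply, ← finsetSum_coeff, ← derivative_rowDet_staircase, coeff_derivative,
    Pi.smul_apply, smul_eq_mul, mul_comm]

theorem sum_dividedDiff_pow (N d : ℕ) :
    ((∑ a ∈ Icc 1 N, dividedDiff a) ^ d) (fun x => (rowDet x.1 (staircase N)).coeff 0) =
      (d.factorial : ℚ) • fun x => (rowDet x.1 (staircase N)).coeff d := by
  induction d with
  | zero => simp
  | succ d ih =>
    rw [pow_succ', Module.End.mul_apply, ih, map_smul, sum_dividedDiff_coeff_rowDet, smul_smul,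
      Nat.factorial_succ]
    push_cast
    rw [mul_comm]

/-- The numbers `∏_{t < j} (2t + 3) / (2t + 2)`. -/
def growth (j : ℕ) : ℚ := ∏ t ∈ range j, (2 * t + 3 : ℚ) / (2 * t + 2)

theorem growth_eq (j : ℕ) :
    growth j = 2 * (j + 1) * ∏ t ∈ range (j + 1), (2 * t + 1 : ℚ) / (2 * t + 2) := by
  induction j with
  | zero => simp [growth]
  | succ j ih =>
    rw [growth, prod_range_succ, ← growth, ih, prod_range_succ _ (j + 1)]
    have : (2 * j + 2 : ℚ) ≠ 0 := by positivity
    push_cast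
    field_simp
    ring

theorem prod_staircase {N : ℕ} (k : Fin N) :
    (staircase N k.castSucc : ℚ) * ∏ j ∈ univ.erase k.castSucc,
      (((staircase N k.castSucc - 1 : ℕ) : ℚ) - staircase N j) /
        (staircase N k.castSucc - staircase N j) = growth k * growth (N - 1 - k) := by
  obtain ⟨k, hk⟩ := k
  obtain ⟨M, rfl⟩ : ∃ M, N = k + (M + 1) := ⟨N - k - 1, by omega⟩
  have hcast (j : Fin (k + (M + 1) + 1)) :
      (staircase (k + (M + 1)) j : ℚ) = 2 * ((k + (M + 1) : ℕ) - (j : ℕ)) := by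
    rw [staircase, Nat.cast_mul, Nat.cast_sub (by omega)]
    rfl
  have hpos : 1 ≤ staircase (k + (M + 1)) (Fin.castSucc ⟨k, hk⟩) := by simp [staircase]; omega
  rw [Nat.cast_sub hpos]
  simp only [hcast, Fin.val_castSucc]
  set g : ℕ → ℚ := fun j => if j = k then 1 else (2 * ((j : ℚ) - k) - 1) / (2 * (j - k)) with hg
  have h1 : ∏ j ∈ univ.erase (Fin.castSucc ⟨k, hk⟩),
      (2 * (((k + (M + 1) : ℕ) : ℚ) - k) - (1 : ℕ) - 2 * ((k + (M + 1) : ℕ) - (j : ℕ))) /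
        (2 * (((k + (M + 1) : ℕ) : ℚ) - k) - 2 * ((k + (M + 1) : ℕ) - (j : ℕ))) =
      ∏ j ∈ univ.erase (Fin.castSucc ⟨k, hk⟩), g j := by
    refine prod_congr rfl fun j hj => ?_
    have hj' : (j : ℕ) ≠ k := fun h => ne_of_mem_erase hj (Fin.ext h)
    rw [hg]
    simp only [if_neg hj']
    push_cast
    congr 1 <;> ring
  have h2 : ∏ t ∈ range k, g t = growth k := by
    rw [← prod_range_reflect, growth]
    refine prod_congr rfl fun t ht => ?_
    rw [mem_range] at ht
    obtain ⟨s, rfl⟩ : ∃ s, k = s + t + 1 := ⟨k - t - 1, by omega⟩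
    rw [show s + t + 1 - 1 - t = s by omega, hg]
    simp only [show s ≠ s + t + 1 by omega, if_false]
    push_cast
    rw [div_eq_div_iff (by intro h; linarith [(t.cast_nonneg : (0 : ℚ) ≤ t)]) (by positivity)]
    ring
  have h3 : ∏ t ∈ range (M + 1), g (k + (t + 1)) =
      ∏ t ∈ range (M + 1), (2 * t + 1 : ℚ) / (2 * t + 2) := by
    refine prod_congr rfl fun t _ => ?_
    rw [hg]
    simp only [show k + (t + 1) ≠ k by omega, if_false]
    push_cast
    congr 1 <;> ring
  rw [h1, prod_erase _ (by simp [hg]), Fin.prod_univ_eq_prod_range, add_assoc, prod_range_add, h2,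
    prod_range_succ', h3, show k + (M + 1) - 1 - k = M by omega, growth_eq M]
  simp [hg]
  ring

theorem card_longReducedHead {N : ℕ} (k : Fin N) :
    ((N + 1).choose 2 : ℚ) * #(longReducedHead (N + 1) (k + 1)) =
      #(longReduced (N + 1)) * (growth k * growth (N - 1 - k)) := by
  have hN : 1 ≤ N := k.pos
  obtain ⟨T, hT, hTk⟩ := isNilCoxeter_dividedDiff.exists_sum_pow (n := N + 1) (by omega)
  specialize hTk (k + 1) (by rw [mem_Icc]; omega)
  rw [Nat.add_sub_cancel] at hT hTk
  set m := (N + 1).choose 2 with hm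
  have hm1 : 1 ≤ m := Nat.choose_pos (show 2 ≤ N + 1 by omega)
  have hsum : m + ∑ j : Fin (N + 1), (j : ℕ) = ∑ i, staircase N i := by
    have h1 : ∑ j : Fin (N + 1), (j : ℕ) = m := by
      rw [Fin.sum_univ_eq_sum_range (fun j => j), sum_range_id, hm, Nat.choose_two_right]
    have h2 : ∑ i, staircase N i = 2 * ∑ j : Fin (N + 1), (j : ℕ) := by
      simp only [staircase]
      rw [← mul_sum, Fin.sum_univ_eq_sum_range (fun j => N - j), Fin.sum_univ_eq_sum_range
        (fun j => j), ← sum_range_reflect (fun j => j)]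
      rfl
    rw [h2, h1, two_mul]
  let x : Points := ⟨fun i => i, Nat.cast_injective⟩
  let F : Points → ℚ := fun x => (rowDet x.1 (staircase N)).coeff 0
  have e1 := congrFun (LinearMap.congr_fun hT F) x
  have e2 := congrFun (LinearMap.congr_fun hTk F) x
  rw [sum_dividedDiff_pow, Pi.smul_apply, coeff_rowDet x.1 _ hsum, LinearMap.smul_apply,
    Pi.smul_apply, smul_eq_mul, nsmul_eq_mul] at e1
  have hpos : 1 ≤ staircase N k.castSucc := by simp [staircase]; omega
  have hsum' : m - 1 + ∑ j : Fin (N + 1), (j : ℕ) = ∑ i, loweredStaircase N k i := by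
    rw [loweredStaircase, sum_update_of_mem (mem_univ _)]
    have := sum_sdiff (f := staircase N) (subset_univ {k.castSucc})
    rw [sum_singleton] at this
    omega
  rw [Module.End.mul_apply, sum_dividedDiff_pow, map_smul, dividedDiff_coeff_rowDet, Pi.smul_apply,
    coeff_rowDet x.1 _ hsum', LinearMap.smul_apply, Pi.smul_apply, smul_eq_mul, nsmul_eq_mul] at e2
  have hinj : Function.Injective fun i => (staircase N i : ℚ) := fun i j h => by
    have h' : staircase N i = staircase N j := by simpa using h
    simp only [staircase] at h'
    exact Fin.ext (by omega)
  have hvand : (Matrix.vandermonde fun i => (loweredStaircase N k i : ℚ)) =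
      Matrix.vandermonde (Function.update (fun i => (staircase N i : ℚ)) k.castSucc
        ((staircase N k.castSucc - 1 : ℕ) : ℚ)) := by
    congr 1
    ext i
    rw [loweredStaircase]
    by_cases hi : i = k.castSucc
    · subst hi
      simp
    · simp [Function.update_of_ne hi]
  have hfact : ∏ i, ((loweredStaircase N k i).factorial : ℚ)⁻¹ =
      staircase N k.castSucc * ∏ i, ((staircase N i).factorial : ℚ)⁻¹ := by
    rw [← mul_prod_erase univ _ (mem_univ k.castSucc), ← mul_prod_erase univ (fun i =>
      ((staircase N i).factorial : ℚ)⁻¹) (mem_univ k.castSucc), ← mul_assoc]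
    congr 1
    · rw [loweredStaircase, Function.update_self]
      obtain ⟨b, hb⟩ := Nat.exists_eq_succ_of_ne_zero (show staircase N k.castSucc ≠ 0 by omega)
      rw [hb, Nat.factorial_succ, Nat.succ_sub_one]
      have := Nat.factorial_ne_zero b
      push_cast
      field_simp
    · refine prod_congr rfl fun i hi => ?_
      rw [loweredStaircase, Function.update_of_ne (ne_of_mem_erase hi)]
  rw [hvand, det_vandermonde_update hinj, hfact] at e2
  set D := (Matrix.vandermonde fun i => (staircase N i : ℚ)).det with hD
  have hD0 : D ≠ 0 := Matrix.det_vandermonde_ne_zero_iff.2 hinj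
  set P := ∏ i, ((staircase N i).factorial : ℚ)⁻¹ with hP
  have hP0 : P ≠ 0 := prod_ne_zero_iff.2 fun i _ =>
    inv_ne_zero (by exact_mod_cast Nat.factorial_ne_zero _)
  have hf : (m.factorial : ℚ) = m * (m - 1).factorial := by
    exact_mod_cast (Nat.mul_factorial_pred (by omega)).symm
  have hT0 : T F x * #(longReduced (N + 1)) ≠ 0 := by
    rw [mul_comm, ← e1]
    have := Nat.factorial_ne_zero m
    positivity
  have hf0 : ((m - 1).factorial : ℚ) ≠ 0 := by exact_mod_cast Nat.factorial_ne_zero _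
  rw [← prod_staircase]
  rw [hf] at e1
  generalize ∏ j ∈ univ.erase k.castSucc,
    (((staircase N k.castSucc - 1 : ℕ) : ℚ) - staircase N j) /
      (staircase N k.castSucc - staircase N j) = Q at e2 ⊢
  have hT1 : T F x ≠ 0 := left_ne_zero_of_mul hT0
  apply mul_right_cancel₀ (mul_ne_zero hT1 (mul_ne_zero hf0 (mul_ne_zero hP0 hD0)))
  linear_combination (-(m * (m - 1).factorial * P * D : ℚ)) * e2 +
    ((m - 1).factorial * staircase N k.castSucc * P * Q * D : ℚ) * e1

/-! ### Convolution sums -/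

theorem succ_mul_growth_succ (j : ℕ) :
    ((j + 1 : ℕ) : ℚ) * growth (j + 1) = (j + 3 / 2) * growth j := by
  rw [growth, prod_range_succ, ← growth]
  push_cast
  field_simp

theorem sum_growth_mul (N : ℕ) :
    ∑ p ∈ antidiagonal N, growth p.1 * growth p.2 = (N + 1) * (N + 2) / 2 := by
  have hsymm (N : ℕ) : 2 * ∑ p ∈ antidiagonal N, (p.1 : ℚ) * growth p.1 * growth p.2 =
      N * ∑ p ∈ antidiagonal N, growth p.1 * growth p.2 := by
    rw [two_mul]
    nth_rw 2 [← Finset.Nat.sum_antidiagonal_swap]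
    rw [← sum_add_distrib, mul_sum]
    refine sum_congr rfl fun p hp => ?_
    rw [← mem_antidiagonal.1 hp, Prod.fst_swap, Prod.snd_swap]
    push_cast
    ring
  induction N with
  | zero => simp [growth]
  | succ N ih =>
    have h := hsymm (N + 1)
    rw [Finset.Nat.sum_antidiagonal_succ] at h
    simp only [succ_mul_growth_succ, Nat.cast_zero, zero_mul, zero_add, add_mul,
      sum_add_distrib, mul_assoc, ← mul_sum] at h
    have h' := hsymm N
    simp only [mul_assoc] at h'
    rw [ih] at h h'
    have h0 : ((N + 1 : ℕ) : ℚ) ≠ 0 := by positivity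
    apply mul_left_cancel₀ h0
    rw [← h]
    push_cast
    linear_combination h'

theorem sum_mul_growth_mul (N : ℕ) :
    ∑ p ∈ antidiagonal N, (p.1 * growth p.1) * (p.2 * growth p.2) =
      3 / 32 * ((N + 2) * (N + 1) * N * (N - 1)) := by
  induction N using Nat.twoStepInduction with
  | zero => simp
  | one => simp [Finset.Nat.antidiagonal_succ]
  | more N ih _ =>
    rw [Finset.Nat.sum_antidiagonal_succ, Finset.Nat.sum_antidiagonal_succ']
    simp only [succ_mul_growth_succ, Nat.cast_zero, zero_mul, mul_zero, zero_add]
    have : ∀ p ∈ antidiagonal N, (p.1 + 3 / 2) * growth p.1 * ((p.2 + 3 / 2) * growth p.2) =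
        (p.1 * growth p.1) * (p.2 * growth p.2) +
          (3 / 2 * N + 9 / 4) * (growth p.1 * growth p.2) := fun p hp => by
      rw [← mem_antidiagonal.1 hp]
      push_cast
      ring
    rw [sum_congr rfl this, sum_add_distrib, ← mul_sum, ih, sum_growth_mul]
    push_cast
    ring

theorem cast_choose_four (N : ℕ) :
    ((N + 2).choose 4 : ℚ) = (N + 2) * (N + 1) * N * (N - 1) / 24 := by
  have h : ((N + 2).choose 4 * 24 : ℚ) = (N + 2) * (N + 1) * N * (N - 1) := by
    have h1 := Nat.add_one_mul_choose_eq (N + 1) 3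
    have h2 := Nat.add_one_mul_choose_eq N 2
    have h4 : ((N.choose 2 : ℕ) : ℚ) = N * (N - 1) / 2 := Nat.cast_choose_two ℚ N
    qify at h1 h2
    rw [h4] at h2
    push_cast at h1 h2
    linear_combination (-6) * h1 - 2 * (N + 2) * h2
  rw [← h]
  ring

/-! ### Rotating reduced words -/

/-- Move the first letter of a word to the end, reflecting it. -/
def rotate (n : ℕ) : List ℕ → List ℕ
  | [] => []
  | a :: u => u ++ [n - a]

theorem longWord_mul_adj {n a : ℕ} (ha : 1 ≤ a) (han : a + 1 ≤ n) :
    longWord n * adjTransposition (n - a) = adjTransposition a * longWord n := by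
  ext i
  change (if 1 ≤ adjTransposition (n - a) i ∧ adjTransposition (n - a) i ≤ n then
    n + 1 - adjTransposition (n - a) i else adjTransposition (n - a) i) =
      adjTransposition a (if 1 ≤ i ∧ i ≤ n then n + 1 - i else i)
  simp only [adj_apply]
  split_ifs <;> omega

theorem rotate_mem {n : ℕ} {w : List ℕ} (hw : w ∈ longReduced n) :
    rotate n w ∈ longReduced n := by
  rw [mem_longReduced_iff] at hw ⊢
  obtain ⟨hl, hlet, hp⟩ := hw
  cases w with
  | nil => exact ⟨hl, hlet, hp⟩
  | cons a u =>
    have ha := hlet a List.mem_cons_self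
    refine ⟨by simpa [rotate] using hl, fun b hb => ?_, ?_⟩
    · rw [rotate, List.mem_append, List.mem_singleton] at hb
      rcases hb with hb | rfl
      · exact hlet b (List.mem_cons_of_mem a hb)
      · omega
    · rw [List.map_cons, List.prod_cons] at hp
      have hu : (u.map adjTransposition).prod = adjTransposition a * longWord n := by
        rw [← hp, ← mul_assoc, adj_mul_self, one_mul]
      rw [rotate, List.map_append, List.prod_append, hu, List.map_singleton, List.prod_singleton,
        mul_assoc, longWord_mul_adj ha.1 (by omega), ← mul_assoc, adj_mul_self, one_mul]

theorem rotate_injOn (n : ℕ) : Set.InjOn (rotate n) (longReduced n) := by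
  intro w hw v hv h
  rw [mem_coe, mem_longReduced_iff] at hw hv
  have hlen : w.length = v.length := hw.1.trans hv.1.symm
  cases w with
  | nil => exact (List.length_eq_zero_iff.1 hlen.symm).symm
  | cons a u =>
    cases v with
    | nil => simp at hlen
    | cons b v =>
      rw [rotate, rotate, List.append_singleton_inj] at h
      have ha := hw.2.1 a List.mem_cons_self
      have hb := hv.2.1 b List.mem_cons_self
      rw [h.1, show a = b by omega]

theorem sum_rotate {M : Type*} [AddCommMonoid M] (n : ℕ) (f : List ℕ → M) :
    ∑ w ∈ longReduced n, f (rotate n w) = ∑ w ∈ longReduced n, f w :=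
  sum_nbij (rotate n) (fun _ => rotate_mem) (rotate_injOn n)
    (surjOn_of_injOn_of_card_le _ (fun _ => rotate_mem) (rotate_injOn n) le_rfl) fun _ _ => rfl

theorem sum_getD_longReduced {M : Type*} [AddCommMonoid M] (n : ℕ) (f : ℕ → M) {i : ℕ}
    (hi : i < n.choose 2) :
    ∑ w ∈ longReduced n, f (w.getD i 0) = ∑ w ∈ longReduced n, f (w.getD 0 0) := by
  induction i with
  | zero => rfl
  | succ i ih =>
    rw [← ih (by omega), ← sum_rotate n fun w => f (w.getD i 0)]
    refine sum_congr rfl fun w hw => ?_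
    have hl := (mem_longReduced_iff.1 hw).1
    cases w with
    | nil => simp at hl; omega
    | cons a u =>
      rw [List.length_cons] at hl
      rw [rotate, List.getD_cons_succ, List.getD_append _ _ _ _ (by omega)]

theorem sum_map_eq_sum_getD {M : Type*} [AddCommMonoid M] (w : List ℕ) (f : ℕ → M) :
    (w.map f).sum = ∑ i ∈ range w.length, f (w.getD i 0) := by
  induction w with
  | nil => simp
  | cons a u ih =>
    rw [List.map_cons, List.sum_cons, ih, List.length_cons, sum_range_succ', add_comm]
    simp

theorem sum_sum_longReduced (N : ℕ) (f : ℕ → ℚ) :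
    ∑ w ∈ longReduced (N + 1), (w.map f).sum =
      ∑ k : Fin N, (N + 1).choose 2 * (f (k + 1) * #(longReducedHead (N + 1) (k + 1))) := by
  have h1 : ∑ w ∈ longReduced (N + 1), (w.map f).sum =
      ∑ w ∈ longReduced (N + 1), ∑ i ∈ range ((N + 1).choose 2), f (w.getD i 0) :=
    sum_congr rfl fun w hw => by
      rw [sum_map_eq_sum_getD, (mem_longReduced_iff.1 hw).1]
  rw [h1, sum_comm, sum_congr rfl fun i hi => sum_getD_longReduced (N + 1) f (mem_range.1 hi),
    sum_const, card_range, nsmul_eq_mul, ← mul_sum]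
  rcases Nat.eq_zero_or_pos N with rfl | hN
  · simp
  congr 1
  have h2 : ∀ w ∈ longReduced (N + 1), ∃ a,
      (1 ≤ a ∧ a ≤ N) ∧ w.head? = some a ∧ w.getD 0 0 = a := by
    intro w hw
    obtain ⟨hl, hlet, -⟩ := mem_longReduced_iff.1 hw
    cases w with
    | nil =>
      have := Nat.choose_pos (show 2 ≤ N + 1 by omega)
      simp at hl
      omega
    | cons a u => exact ⟨a, hlet a List.mem_cons_self, rfl, rfl⟩
  rw [Fin.sum_univ_eq_sum_range (fun k => f (k + 1) * (#(longReducedHead (N + 1) (k + 1)) : ℚ)),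
    ← sum_fiberwise_of_maps_to (g := fun w => w.getD 0 0 - 1) (t := range N)]
  · refine sum_congr rfl fun k hk => ?_
    have h3 : longReducedHead (N + 1) (k + 1) =
        {w ∈ longReduced (N + 1) | w.getD 0 0 - 1 = k} := by
      refine filter_congr fun w hw => ?_
      obtain ⟨a, ha, h, h'⟩ := h2 w hw
      rw [h, h', Option.some_inj]
      omega
    rw [h3, mul_comm, ← nsmul_eq_mul, ← sum_const]
    refine sum_congr rfl fun w hw => ?_
    rw [mem_filter] at hw
    obtain ⟨a, ha, h, h'⟩ := h2 w hw.1
    rw [h'] at hw ⊢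
    congr 1
    omega
  · intro w hw
    obtain ⟨a, ha, h, h'⟩ := h2 w hw
    rw [h', mem_range]
    omega

theorem sum_sum_crossing (N : ℕ) :
    ∑ w ∈ longReduced (N + 1), (w.map fun a => ((a - 1) * (N - a) : ℕ)).sum * 4 =
      9 * (N + 1).choose 4 * #(longReduced (N + 1)) := by
  rw [← sum_mul]
  have h := sum_sum_longReduced N fun a => (((a - 1) * (N - a) : ℕ) : ℚ)
  rcases Nat.eq_zero_or_pos N with rfl | hN
  · simp [Nat.choose_eq_zero_of_lt]
  obtain ⟨M, rfl⟩ : ∃ M, N = M + 1 := ⟨N - 1, by omega⟩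
  have h1 : ∀ k : Fin (M + 1), ((M + 1 + 1).choose 2 : ℚ) *
      ((((k + 1 - 1 : ℕ) * (M + 1 - (k + 1 : ℕ)) : ℕ) : ℚ) *
        #(longReducedHead (M + 1 + 1) (k + 1))) =
      #(longReduced (M + 1 + 1)) *
        (((k : ℕ) * growth k) * (((M - k : ℕ) : ℚ) * growth (M - k))) := by
    intro k
    have := card_longReducedHead k
    rw [show M + 1 - (k + 1) = M - k by omega, Nat.add_sub_cancel, Nat.cast_mul]
    rw [Nat.add_sub_cancel] at this
    linear_combination ((k : ℕ) : ℚ) * ((M - k : ℕ) : ℚ) * this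
  rw [sum_congr rfl fun k _ => h1 k, ← mul_sum, Fin.sum_univ_eq_sum_range
    (fun k => (k * growth k) * (((M - k : ℕ) : ℚ) * growth (M - k))),
    ← Finset.Nat.sum_antidiagonal_eq_sum_range_succ
    (fun i j => (i * growth i) * (j * growth j)), sum_mul_growth_mul] at h
  have h4 := cast_choose_four M
  have : ((∑ w ∈ longReduced (M + 1 + 1),
      (w.map fun a => ((a - 1) * (M + 1 - a) : ℕ)).sum : ℕ) : ℚ) * 4 =
      9 * ((M + 2).choose 4) * #(longReduced (M + 1 + 1)) := by
    rw [h4]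
    push_cast [Nat.cast_list_sum, List.map_map, Function.comp_def] at h ⊢
    linear_combination 4 * h
  exact_mod_cast this

/-! ### The induced word as a path in the weak order on `S_4` -/

/-- The number of wires of `A` among the first `q` positions of `π`. -/
def rank (A : Finset ℕ) (π : Equiv.Perm ℕ) (q : ℕ) : ℕ := #{p ∈ Icc 1 q | π p ∈ A}

theorem rank_succ (A : Finset ℕ) (π : Equiv.Perm ℕ) (q : ℕ) :
    rank A π (q + 1) = rank A π q + if π (q + 1) ∈ A then 1 else 0 := by
  rw [rank, rank, ← insert_Icc_right_eq_Icc_add_one (by omega), filter_insert]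
  split_ifs
  · rw [card_insert_of_notMem (by simp)]
  · rfl

theorem rank_mono (A : Finset ℕ) (π : Equiv.Perm ℕ) : Monotone (rank A π) :=
  monotone_nat_of_le_succ fun q => by rw [rank_succ]; omega

theorem rank_lt {A : Finset ℕ} {π : Equiv.Perm ℕ} {p q : ℕ} (h : p < q) (hq : π q ∈ A) :
    rank A π p < rank A π q := by
  obtain ⟨q, rfl⟩ := Nat.exists_eq_succ_of_ne_zero (show q ≠ 0 by omega)
  have := rank_mono A π (Nat.lt_succ_iff.1 h)
  rw [Nat.succ_eq_add_one, rank_succ, if_pos hq]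
  omega

theorem rank_injOn {A : Finset ℕ} {π : Equiv.Perm ℕ} {p q : ℕ} (hp : π p ∈ A) (hq : π q ∈ A)
    (h : rank A π p = rank A π q) : p = q := by
  rcases lt_trichotomy p q with hlt | rfl | hlt
  · exact absurd h (rank_lt hlt hq).ne
  · rfl
  · exact absurd h (rank_lt hlt hp).ne'

theorem rank_le_card (A : Finset ℕ) (π : Equiv.Perm ℕ) (q : ℕ) : rank A π q ≤ #A :=
  card_le_card_of_injOn π (fun _ hp => (mem_filter.1 hp).2) π.injective.injOn

theorem rank_mul_adj {A : Finset ℕ} {π : Equiv.Perm ℕ} {a : ℕ} (ha : 1 ≤ a) {q : ℕ} (hq : q ≠ a) :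
    rank A (π * adjTransposition a) q = rank A π q := by
  rw [rank, rank]
  rcases lt_or_gt_of_ne hq with h | h
  · congr 1
    refine filter_congr fun p hp => ?_
    rw [mem_Icc] at hp
    rw [Equiv.Perm.mul_apply, adj_apply, if_neg (by omega), if_neg (by omega)]
  · refine card_bij' (fun p _ => adjTransposition a p) (fun p _ => adjTransposition a p) ?_ ?_
      (fun p _ => adj_adj a p) (fun p _ => adj_adj a p)
    all_goals
      intro p hp
      rw [mem_filter, mem_Icc] at hp ⊢
      simp only [Equiv.Perm.mul_apply, adj_adj] at hp ⊢
      refine ⟨?_, hp.2⟩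
      rw [adj_apply]
      split_ifs <;> omega

theorem rank_mul_adj_self {A : Finset ℕ} {π : Equiv.Perm ℕ} {a : ℕ} (ha : 1 ≤ a) :
    rank A (π * adjTransposition a) a + (if π a ∈ A then 1 else 0) = rank A π (a + 1) := by
  rw [← rank_mul_adj ha (show a + 1 ≠ a by omega), rank_succ, Equiv.Perm.mul_apply,
    adjTransposition, Equiv.swap_apply_right]

/-- `v` is the sequence of letters of a saturated chain in the weak order from the permutation
whose inverse has values `r` to the long word in `S_4`. -/
def IsChain : List ℕ → List ℕ → Prop
  | r, [] => r = [4, 3, 2, 1]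
  | r, j :: v => [j, j + 1].Sublist r ∧ IsChain (r.map (adjTransposition j)) v

/-- The number of letters `2` in `v` is `3` if `v` is reentrant and `2` otherwise. -/
def CountEq (v : List ℕ) : Prop := v.count 2 = 2 + if v ∈ reentrantSet then 1 else 0

instance : DecidablePred CountEq := fun _ => inferInstanceAs (Decidable (_ = _))

/-- Search through the chains of length less than `k` starting at `r`, verifying `CountEq` for
each of them with `u` prepended, and failing if there is a longer one. -/
def checkChains : ℕ → List ℕ → List ℕ → Bool
  | 0, _, _ => false
  | k + 1, r, u => (r = [4, 3, 2, 1] → CountEq u) && r.all fun j =>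
      !([j, j + 1].isSublist r) || checkChains k (r.map (adjTransposition j)) (u ++ [j])

theorem IsChain.countEq {k : ℕ} {r u v : List ℕ} (hv : IsChain r v) (h : checkChains k r u) :
    CountEq (u ++ v) := by
  induction k generalizing r u v with
  | zero => simp [checkChains] at h
  | succ k ih =>
    simp only [checkChains, Bool.and_eq_true, decide_eq_true_eq, List.all_eq_true,
      Bool.or_eq_true, Bool.not_eq_true', ← Bool.not_eq_true, List.isSublist_iff_sublist] at h
    cases v with
    | nil => simpa using h.1 hv
    | cons j v =>
      have hj := (h.2 j (hv.1.subset List.mem_cons_self)).resolve_left (not_not.2 hv.1)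
      simpa using ih hv.2 hj

theorem IsChain.countEq_of_id {v : List ℕ} (hv : IsChain [1, 2, 3, 4] v) : CountEq v :=
  hv.countEq (k := 7) (u := []) (by decide)

theorem inv_mul_prod_le {n : ℕ} {w : List ℕ} (hw : IsWord n w) (π : Equiv.Perm ℕ) :
    inv n (π * (w.map adjTransposition).prod) ≤ inv n π + w.length := by
  induction w generalizing π with
  | nil => simp
  | cons a w ih =>
    obtain ⟨⟨ha, han⟩, hw⟩ := isWord_cons.1 hw
    have := ih hw (π * adjTransposition a)
    rw [List.map_cons, List.prod_cons, ← mul_assoc, List.length_cons]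
    rcases adj_lt_or_gt π a with h | h
    · rw [inv_mul_adj_of_lt ha han h] at this
      omega
    · have := inv_mul_adj_of_gt ha han h
      omega

/-- The positions, relative to those of the other wires of `A`, of the wires of `A`. -/
def ranks (A : Finset ℕ) (π : Equiv.Perm ℕ) : List ℕ :=
  (A.sort (· ≤ ·)).map fun b => rank A π (π.symm b)

theorem ranks_mul_adj_of_mem {A : Finset ℕ} {π : Equiv.Perm ℕ} {a : ℕ} (ha : 1 ≤ a)
    (h : π a ∈ A) (h' : π (a + 1) ∈ A) :
    ranks A (π * adjTransposition a) =
      (ranks A π).map (adjTransposition (rank A π a)) := by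
  have h0 := rank_succ A π a
  have h1 := rank_mul_adj_self (A := A) (π := π) ha
  rw [if_pos h'] at h0
  rw [if_pos h] at h1
  rw [ranks, ranks, List.map_map]
  refine List.map_congr_left fun b hb => ?_
  rw [mem_sort] at hb
  obtain ⟨q, rfl⟩ := π.surjective b
  have hq : (π * adjTransposition a).symm (π q) = adjTransposition a q := by
    rw [Equiv.symm_apply_eq, Equiv.Perm.mul_apply, adj_adj]
  rw [Function.comp_apply, hq, Equiv.symm_apply_apply, adj_apply, adj_apply]
  by_cases hqa : q = a
  · rw [if_pos hqa, if_pos (by rw [hqa]), rank_mul_adj ha (by omega), h0]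
  by_cases hqa' : q = a + 1
  · rw [if_neg hqa, if_pos hqa', hqa', if_neg (by omega), if_pos h0]
    omega
  · rw [if_neg hqa, if_neg hqa', rank_mul_adj ha hqa, if_neg fun e => hqa (rank_injOn hb h e),
      if_neg fun e => hqa' (rank_injOn hb h' (e.trans h0.symm))]

theorem ranks_mul_adj_of_notMem {A : Finset ℕ} {π : Equiv.Perm ℕ} {a : ℕ} (ha : 1 ≤ a)
    (h : ¬ (π a ∈ A ∧ π (a + 1) ∈ A)) : ranks A (π * adjTransposition a) = ranks A π := by
  have h0 := rank_succ A π a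
  have h1 := rank_mul_adj_self (A := A) (π := π) ha
  rw [ranks, ranks]
  refine List.map_congr_left fun b hb => ?_
  rw [mem_sort] at hb
  obtain ⟨q, rfl⟩ := π.surjective b
  have hq : (π * adjTransposition a).symm (π q) = adjTransposition a q := by
    rw [Equiv.symm_apply_eq, Equiv.Perm.mul_apply, adj_adj]
  rw [hq, Equiv.symm_apply_apply, adj_apply]
  by_cases hqa : q = a
  · rw [hqa] at hb ⊢
    rw [if_pos rfl, rank_mul_adj ha (by omega), h0, if_neg fun h' => h ⟨hb, h'⟩, add_zero]
  by_cases hqa' : q = a + 1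
  · rw [hqa'] at hb ⊢
    rw [if_neg fun h' => h ⟨h', hb⟩] at h1
    rw [if_neg (by omega), if_pos rfl, ← h1, add_zero]
  · rw [if_neg hqa, if_neg hqa', rank_mul_adj ha hqa]

theorem pair_sublist_ranks {A : Finset ℕ} {π : Equiv.Perm ℕ} {a : ℕ}
    (h : π a ∈ A) (h' : π (a + 1) ∈ A) (hlt : π a < π (a + 1)) :
    [rank A π a, rank A π a + 1].Sublist (ranks A π) := by
  have hs : [π a, π (a + 1)].Sublist (A.sort (· ≤ ·)) := by
    refine List.sublist_of_subperm_of_pairwise (r := (· ≤ ·)) ?_ ?_ (pairwise_sort A _)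
    · refine List.subperm_of_subset (by simp [hlt.ne]) ?_
      simp [h, h']
    · simpa using hlt.le
  have := hs.map fun b => rank A π (π.symm b)
  simpa [ranks, rank_succ A π a, h'] using this

theorem one_le_rank {A : Finset ℕ} {π : Equiv.Perm ℕ} {q : ℕ} (hq : 1 ≤ q) (h : π q ∈ A) :
    1 ≤ rank A π q :=
  card_pos.2 ⟨q, mem_filter.2 ⟨mem_Icc.2 ⟨hq, le_rfl⟩, h⟩⟩

theorem exists_sort_eq {A : Finset ℕ} (h : #A = 4) :
    ∃ a b c d, A.sort (· ≤ ·) = [a, b, c, d] ∧ a < b ∧ b < c ∧ c < d ∧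
      a ∈ A ∧ b ∈ A ∧ c ∈ A ∧ d ∈ A := by
  have hl := length_sort (s := A) (· ≤ ·)
  have hs := sortedLT_sort A
  have hm := fun x => mem_sort (s := A) (a := x) (· ≤ ·)
  rw [h] at hl
  obtain ⟨a, b, c, d, e⟩ := List.length_eq_four.1 hl
  rw [e] at hs hm
  have := hs.pairwise
  simp at this
  exact ⟨a, b, c, d, e, by omega, by omega, by omega, by simp [← hm], by simp [← hm],
    by simp [← hm], by simp [← hm]⟩

theorem ranks_one {A : Finset ℕ} {n : ℕ} (hA : A ⊆ Icc 1 n) (h : #A = 4) :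
    ranks A 1 = [1, 2, 3, 4] := by
  obtain ⟨a, b, c, d, e, hab, hbc, hcd, ha, hb, hc, hd⟩ := exists_sort_eq h
  have h1 := one_le_rank (π := 1) (mem_Icc.1 (hA ha)).1 ha
  have h2 := rank_lt (π := 1) hab hb
  have h3 := rank_lt (π := 1) hbc hc
  have h4 := rank_lt (π := 1) hcd hd
  have h5 := rank_le_card A 1 d
  rw [ranks, e]
  change [rank A 1 a, rank A 1 b, rank A 1 c, rank A 1 d] = _
  simp only [List.cons.injEq, and_true]
  omega

theorem ranks_longWord {A : Finset ℕ} {n : ℕ} (hA : A ⊆ Icc 1 n) (h : #A = 4) :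
    ranks A (longWord n) = [4, 3, 2, 1] := by
  obtain ⟨a, b, c, d, e, hab, hbc, hcd, ha, hb, hc, hd⟩ := exists_sort_eq h
  have hinv : (longWord n).symm = longWord n := longWord_inv n
  have hself (x : ℕ) : longWord n (longWord n x) = x := by
    rw [← Equiv.Perm.mul_apply, longWord_mul_self, Equiv.Perm.one_apply]
  have hap {x : ℕ} (hx : x ∈ A) : longWord n x = n + 1 - x ∧ 1 ≤ x ∧ x ≤ n := by
    have := mem_Icc.1 (hA hx)
    exact ⟨longWord_apply this.1 this.2, this⟩
  have hlt {x y : ℕ} (hx : x ∈ A) (hy : y ∈ A) (hxy : x < y) :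
      rank A (longWord n) (longWord n y) < rank A (longWord n) (longWord n x) := by
    refine rank_lt ?_ (by rwa [hself])
    have := hap hx
    have := hap hy
    omega
  have h1 := one_le_rank (A := A) (π := longWord n) (q := longWord n d)
    (by have := hap hd; omega) (by rwa [hself])
  have h2 := hlt ha hb hab
  have h3 := hlt hb hc hbc
  have h4 := hlt hc hd hcd
  have h5 := rank_le_card A (longWord n) (longWord n a)
  rw [ranks, e, hinv]
  simp only [List.map_cons, List.map_nil, List.cons.injEq, and_true]
  omega

theorem isChain_inducedAux {n : ℕ} {A : Finset ℕ} (hA : A ⊆ Icc 1 n) (hA4 : #A = 4)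
    {w : List ℕ} (hw : IsWord n w) {π : Equiv.Perm ℕ}
    (hπ : π * (w.map adjTransposition).prod = longWord n)
    (hinv : inv n π + w.length = n.choose 2) : IsChain (ranks A π) (inducedAux A w π) := by
  induction w generalizing π with
  | nil =>
    rw [List.map_nil, List.prod_nil, mul_one] at hπ
    rw [hπ]
    exact ranks_longWord hA hA4
  | cons a w ih =>
    obtain ⟨⟨ha, han⟩, hw⟩ := isWord_cons.1 hw
    rw [List.map_cons, List.prod_cons, ← mul_assoc] at hπ
    rw [List.length_cons] at hinv
    have hle := inv_mul_prod_le hw (π * adjTransposition a)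
    rw [hπ, inv_longWord] at hle
    have hlt : π a < π (a + 1) := (adj_lt_or_gt π a).resolve_right fun h => by
      have := inv_mul_adj_of_gt ha han h
      omega
    have := ih hw hπ (by rw [inv_mul_adj_of_lt ha han hlt]; omega)
    rw [inducedAux]
    split_ifs with h
    · rw [ranks_mul_adj_of_mem ha h.1 h.2] at this
      exact ⟨pair_sublist_ranks h.1 h.2 hlt, this⟩
    · rwa [ranks_mul_adj_of_notMem ha h] at this

theorem count_inducedWord {n : ℕ} {A : Finset ℕ} (hA : A ∈ powersetCard 4 (Icc 1 n)) {w : List ℕ}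
    (hw : IsReducedWord n w) : (inducedWord w A).count 2 =
      2 + if inducedWord w A ∈ reentrantSet then 1 else 0 := by
  obtain ⟨hA, hA4⟩ := mem_powersetCard.1 hA
  refine IsChain.countEq_of_id ?_
  rw [← ranks_one hA hA4]
  refine isChain_inducedAux hA hA4 (fun a ha => ?_) (by rw [one_mul, hw.2.2]) ?_
  · have := hw.2.1 a ha
    omega
  · rw [inv_one, zero_add, hw.1]

/-! ### Counting the letter `2` in induced words -/

theorem card_filter_mem_mem_rank {n a : ℕ} (ha : 1 ≤ a) (han : a + 1 ≤ n) :
    #{B ∈ powersetCard 4 (Icc 1 n) | (a ∈ B ∧ a + 1 ∈ B) ∧ #{p ∈ Icc 1 a | p ∈ B} = 2} =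
      (a - 1) * (n - 1 - a) := by
  have hcard : #(Icc 1 (a - 1) ×ˢ Icc (a + 2) n) = (a - 1) * (n - 1 - a) := by
    rw [card_product, Nat.card_Icc, Nat.card_Icc]
    congr 1
    omega
  rw [← hcard]
  symm
  refine card_bij (fun x _ => {x.1, a, a + 1, x.2}) ?_ ?_ ?_
  · rintro ⟨p, q⟩ h
    simp only [mem_product, mem_Icc] at h
    rw [mem_filter, mem_powersetCard]
    refine ⟨⟨?_, ?_⟩, by simp, ?_⟩
    · intro x hx
      simp only [mem_insert, mem_singleton] at hx
      rw [mem_Icc]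
      omega
    · rw [card_insert_of_notMem (by simp; omega), card_insert_of_notMem (by simp; omega),
        card_pair (by omega)]
    · have : ({x ∈ Icc 1 a | x ∈ ({p, a, a + 1, q} : Finset ℕ)} : Finset ℕ) = {p, a} := by
        ext x
        simp only [mem_filter, mem_Icc, mem_insert, mem_singleton]
        omega
      rw [this, card_pair (by omega)]
  · rintro ⟨p, q⟩ h ⟨p', q'⟩ h' e
    simp only [mem_product, mem_Icc] at h h'
    have h1 := Finset.ext_iff.1 e p
    have h2 := Finset.ext_iff.1 e q
    simp only [mem_insert, mem_singleton, true_or, or_true, true_iff] at h1 h2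
    rw [Prod.mk.injEq]
    omega
  · intro B hB
    rw [mem_filter, mem_powersetCard] at hB
    obtain ⟨⟨hB, hB4⟩, ⟨h, h'⟩, hB2⟩ := hB
    obtain ⟨x, y, hxy, e⟩ := card_eq_two.1 hB2
    have hlow (p : ℕ) : (1 ≤ p ∧ p ≤ a) ∧ p ∈ B ↔ p = x ∨ p = y := by
      have := Finset.ext_iff.1 e p
      simpa using this
    obtain ⟨p, hp1, hpa, hpB, hp⟩ : ∃ p, 1 ≤ p ∧ p < a ∧ p ∈ B ∧ ∀ t ∈ B, t < a → t = p := by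
      have hx := (hlow x).2 (.inl rfl)
      have hy := (hlow y).2 (.inr rfl)
      have haxy := (hlow a).1 ⟨⟨ha, le_rfl⟩, h⟩
      rcases haxy with rfl | rfl
      · exact ⟨y, hy.1.1, by omega, hy.2, fun t ht hta => by
          have := (hlow t).1 ⟨⟨(mem_Icc.1 (hB ht)).1, by omega⟩, ht⟩
          omega⟩
      · exact ⟨x, hx.1.1, by omega, hx.2, fun t ht hta => by
          have := (hlow t).1 ⟨⟨(mem_Icc.1 (hB ht)).1, by omega⟩, ht⟩
          omega⟩
    have hsub : {p, a, a + 1} ⊆ B := by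
      simp [insert_subset_iff, h, h', hpB]
    have hc : #(B \ {p, a, a + 1}) = 1 := by
      rw [card_sdiff_of_subset hsub, hB4, card_eq_three.2 ⟨p, a, a + 1, by omega, by omega,
        by omega, rfl⟩]
    obtain ⟨q, hq⟩ := card_eq_one.1 hc
    have hq' (t : ℕ) : t ∈ B ∧ ¬ (t = p ∨ t = a ∨ t = a + 1) ↔ t = q := by
      have := Finset.ext_iff.1 hq t
      simpa using this
    have hqB := (hq' q).2 rfl
    have hqa : a < q := by
      by_contra hlt
      have := hp q hqB.1 (by omega)
      omega
    refine ⟨(p, q), ?_, ?_⟩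
    · have := mem_Icc.1 (hB hqB.1)
      simp only [mem_product, mem_Icc]
      omega
    · ext t
      simp only [mem_insert, mem_singleton]
      constructor
      · rintro (rfl | rfl | rfl | rfl)
        exacts [hpB, h, h', hqB.1]
      · intro ht
        by_cases h0 : t = p ∨ t = a ∨ t = a + 1
        · tauto
        · exact .inr (.inr (.inr ((hq' t).1 ⟨ht, h0⟩)))

theorem card_filter_crossing {n a : ℕ} {π : Equiv.Perm ℕ} (hπ : FixesOutside n π) (ha : 1 ≤ a)
    (han : a + 1 ≤ n) :
    #{A ∈ powersetCard 4 (Icc 1 n) | (π a ∈ A ∧ π (a + 1) ∈ A) ∧ #{p ∈ Icc 1 a | π p ∈ A} = 2} =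
      (a - 1) * (n - 1 - a) := by
  rw [← card_filter_mem_mem_rank ha han]
  symm
  have hI : (Icc 1 n).map π.toEmbedding = Icc 1 n := by
    refine eq_of_subset_of_card_le (fun x hx => ?_) (by rw [card_map])
    obtain ⟨y, hy, rfl⟩ := mem_map.1 hx
    exact (hπ.mem_iff y).2 hy
  nth_rw 2 [← hI]
  rw [powersetCard_map, filter_map, card_map]
  congr 1
  refine filter_congr fun B _ => ?_
  simp

theorem sum_count_inducedAux {n : ℕ} {w : List ℕ} (hw : IsWord n w) {π : Equiv.Perm ℕ}
    (hπ : FixesOutside n π) : ∑ A ∈ powersetCard 4 (Icc 1 n), (inducedAux A w π).count 2 =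
      (w.map fun a => (a - 1) * (n - 1 - a)).sum := by
  induction w generalizing π with
  | nil => simp [inducedAux]
  | cons a w ih =>
    obtain ⟨⟨ha, han⟩, hw⟩ := isWord_cons.1 hw
    simp only [inducedAux, List.count_append, sum_add_distrib]
    rw [ih hw (hπ.mul (fixesOutside_adj ha han)), List.map_cons, List.sum_cons,
      ← card_filter_crossing hπ ha han, card_filter]
    congr 1
    refine sum_congr rfl fun A _ => ?_
    by_cases h : π a ∈ A ∧ π (a + 1) ∈ A
    · simp [h, List.count_singleton]
    · simp [h]

theorem four_mul_card_reentrant (n : ℕ) :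
    4 * #{p ∈ longReduced n ×ˢ powersetCard 4 (Icc 1 n) | inducedWord p.1 p.2 ∈ reentrantSet} =
      n.choose 4 * #(longReduced n) := by
  obtain _ | N := n
  · simp
  have h := sum_sum_crossing N
  have h1 : ∀ w ∈ longReduced (N + 1), (w.map fun a => ((a - 1) * (N - a) : ℕ)).sum =
      2 * (N + 1).choose 4 +
        #{A ∈ powersetCard 4 (Icc 1 (N + 1)) | inducedWord w A ∈ reentrantSet} := fun w hw => by
    have hw' := mem_longReduced_iff.1 hw
    have h2 := sum_count_inducedAux (n := N + 1) (w := w) (fun a ha => by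
      have := hw'.2.1 a ha
      omega) (fixesOutside_one _)
    rw [Nat.add_sub_cancel] at h2
    rw [← h2, card_filter, mul_comm, ← smul_eq_mul]
    have h3 : (N + 1).choose 4 = #(powersetCard 4 (Icc 1 (N + 1))) := by simp
    rw [h3, ← sum_const, ← sum_add_distrib]
    exact sum_congr rfl fun A hA => count_inducedWord hA hw'
  rw [← sum_mul, sum_congr rfl h1, sum_add_distrib, sum_const, smul_eq_mul] at h
  have h3 : #{p ∈ longReduced (N + 1) ×ˢ powersetCard 4 (Icc 1 (N + 1)) |
      inducedWord p.1 p.2 ∈ reentrantSet} = ∑ w ∈ longReduced (N + 1),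
        #{A ∈ powersetCard 4 (Icc 1 (N + 1)) | inducedWord w A ∈ reentrantSet} := by
    simp only [card_filter, sum_product]
  rw [h3]
  linarith

end SortingNetwork

/-- Sylvester-type conjecture for reduced words (Conjecture 1 of the paper):
for every `n ≥ 4`, four times the number of pairs `(w, A)` — where `w` is a
reduced word for the long word in `S_n` and `A` is a 4-element subset of
`{1, …, n}` whose induced word lies in the reentrant set `X` — equals
`C(n,4)` times the total number of reduced words for the long word;
i.e. the probability of a reentrant induced word is `1/4`. -/
theorem sylvester_reduced_words_prob_one_quarter (n : ℕ) (hn : 4 ≤ n) :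
    4 * Nat.card {p : List ℕ × Finset ℕ //
        IsReducedWord n p.1 ∧ p.2 ⊆ Finset.Icc 1 n ∧ p.2.card = 4 ∧
          inducedWord p.1 p.2 ∈ reentrantSet} =
      n.choose 4 * Nat.card {w : List ℕ // IsReducedWord n w} := by
  have h := SortingNetwork.four_mul_card_reentrant n
  rw [Nat.subtype_card (SortingNetwork.longReduced n) fun _ => SortingNetwork.mem_longReduced_iff,
    ← h, Nat.subtype_card]
  rintro ⟨w, A⟩
  simp [SortingNetwork.mem_longReduced_iff, and_assoc]
end

section
/- The number of pairs (w, A), where w is a reduced word for the long word w0 in S_5 and A is a 4-element subset of {1,2,3,4,5} such that the induced word of w on A belongs to the reentrant set X, is exactly 960. Consequently, since there are 768 reduced words for w0 in S_5, the probability that a uniformly random such pair has reentrant induced word is 960/(C(5,4)·768) = 1/4. -/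
/-- The wires occupying positions `1, …, 5`. -/
structure Wires where
  (p₁ p₂ p₃ p₄ p₅ : ℕ)
  deriving DecidableEq

namespace Wires

/-- The wires occupying positions `1, …, 5` in the permutation `π`. -/
def ofPerm (π : Equiv.Perm ℕ) : Wires := ⟨π 1, π 2, π 3, π 4, π 5⟩

/-- Cross the wires in positions `a` and `a + 1`. -/
def cross : Wires → ℕ → Wires
  | ⟨p, q, r, s, t⟩, 1 => ⟨q, p, r, s, t⟩
  | ⟨p, q, r, s, t⟩, 2 => ⟨p, r, q, s, t⟩
  | ⟨p, q, r, s, t⟩, 3 => ⟨p, q, s, r, t⟩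
  | ⟨p, q, r, s, t⟩, 4 => ⟨p, q, r, t, s⟩
  | l, _ => l

/-- The wires in positions `a` and `a + 1` are in increasing order. -/
def ascends : Wires → ℕ → Bool
  | ⟨p, q, _, _, _⟩, 1 => p.blt q
  | ⟨_, q, r, _, _⟩, 2 => q.blt r
  | ⟨_, _, r, s, _⟩, 3 => r.blt s
  | ⟨_, _, _, s, t⟩, 4 => s.blt t
  | _, _ => false

/-- The number of inversions. -/
def inversions : Wires → ℕ
  | ⟨p, q, r, s, t⟩ =>
    (if q < p then 1 else 0) + (if r < p then 1 else 0) + (if s < p then 1 else 0) +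
    (if t < p then 1 else 0) + (if r < q then 1 else 0) + (if s < q then 1 else 0) +
    (if t < q then 1 else 0) + (if s < r then 1 else 0) + (if t < r then 1 else 0) +
    (if t < s then 1 else 0)

/-- The letter recorded when positions `a` and `a + 1` cross and wire `i` is deleted, if any. -/
def letter (i : ℕ) : Wires → ℕ → List ℕ
  | ⟨p, q, _, _, _⟩, 1 => if p ≠ i ∧ q ≠ i then [1] else []
  | ⟨p, q, r, _, _⟩, 2 =>
    if q ≠ i ∧ r ≠ i then [(if p ≠ i then 1 else 0) + 1] else []
  | ⟨p, q, r, s, _⟩, 3 =>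
    if r ≠ i ∧ s ≠ i then [(if p ≠ i then 1 else 0) + (if q ≠ i then 1 else 0) + 1] else []
  | ⟨p, q, r, s, t⟩, 4 =>
    if s ≠ i ∧ t ≠ i then
      [(if p ≠ i then 1 else 0) + (if q ≠ i then 1 else 0) + (if r ≠ i then 1 else 0) + 1]
    else []
  | _, _ => []

/-- Apply `f` to `l` by way of its components, so that reduction evaluates `l` once. -/
def eval {α : Type} (f : Wires → α) : Wires → α
  | ⟨p, q, r, s, t⟩ => f ⟨p, q, r, s, t⟩

theorem eval_eq {α : Type} (f : Wires → α) (l : Wires) : l.eval f = f l := rfl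

/-- The word induced by deleting wire `i`, starting from a given arrangement of wires. -/
def induced (i : ℕ) : List ℕ → Wires → List ℕ
  | [], _ => []
  | a :: w, l => l.letter i a ++ (l.cross a).eval (induced i w)

/-- The words of length `k` with all crossings ascending that reverse the wires. -/
def reversingWords : ℕ → Wires → List (List ℕ)
  | 0, l => if l = ⟨5, 4, 3, 2, 1⟩ then [[]] else []
  | k + 1, l => ([1, 2, 3, 4].filter l.ascends).flatMap fun a =>
      ((l.cross a).eval (reversingWords k)).map (a :: ·)

/-- The number of words in `reversingWords k l` inducing `x` when wire `i` is deleted. -/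
def countInduced (i : ℕ) : ℕ → List ℕ → Wires → ℕ
  | 0, x, l => if l = ⟨5, 4, 3, 2, 1⟩ ∧ x = [] then 1 else 0
  | k + 1, x, l => (([1, 2, 3, 4].filter l.ascends).map fun a =>
      if l.letter i a <+: x then
        (l.cross a).eval (countInduced i k (x.drop (l.letter i a).length))
      else 0).sum

theorem countInduced_eq (i k : ℕ) (x : List ℕ) (l : Wires) :
    countInduced i k x l = (reversingWords k l).countP fun w => induced i w l = x := by
  induction k generalizing x l with
  | zero =>
    rw [countInduced, reversingWords]
    by_cases hl : l = ⟨5, 4, 3, 2, 1⟩ <;> cases x <;> simp [hl, induced]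
  | succ k ih =>
    rw [countInduced, reversingWords, List.countP_flatMap]
    congr 2
    funext a
    rw [Function.comp_apply, List.countP_map, eval_eq, eval_eq, ih]
    split_ifs with h
    · obtain ⟨y, rfl⟩ := h
      simp [Function.comp_def, induced, eval_eq]
    · refine (List.countP_eq_zero.mpr fun w _ hw => h ?_).symm
      exact ⟨_, of_decide_eq_true hw⟩

theorem ofPerm_mul_adjTransposition (π : Equiv.Perm ℕ) {a : ℕ} (ha : 1 ≤ a ∧ a ≤ 4) :
    ofPerm (π * adjTransposition a) = (ofPerm π).cross a := by
  obtain ⟨h₁, h₂⟩ := ha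
  interval_cases a <;> simp [ofPerm, cross, adjTransposition, Equiv.swap_apply_def]

theorem ofPerm_mul_prod (w : List ℕ) (hw : ∀ a ∈ w, 1 ≤ a ∧ a ≤ 4) (π : Equiv.Perm ℕ) :
    ofPerm (π * (w.map adjTransposition).prod) = w.foldl cross (ofPerm π) := by
  induction w generalizing π with
  | nil => simp
  | cons a w ih =>
    rw [List.forall_mem_cons] at hw
    rw [List.map_cons, List.prod_cons, ← mul_assoc, ih hw.2,
      ofPerm_mul_adjTransposition π hw.1, List.foldl_cons]

theorem inversions_cross_of_ascends {l : Wires} {a : ℕ} (h : l.ascends a) :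
    (l.cross a).inversions = l.inversions + 1 := by
  unfold ascends at h
  split at h <;> simp only [Nat.blt_eq, Bool.false_eq_true] at h
  all_goals
    simp only [cross, inversions, if_pos h, if_neg h.not_gt]
    ring

theorem inversions_cross_le_of_not_ascends {l : Wires} {a : ℕ} (h : ¬ l.ascends a) :
    (l.cross a).inversions ≤ l.inversions := by
  match l, a, h with
  | ⟨_, _, _, _, _⟩, 0, _ => exact le_rfl
  | ⟨_, _, _, _, _⟩, 1, h | ⟨_, _, _, _, _⟩, 2, h | ⟨_, _, _, _, _⟩, 3, h
  | ⟨_, _, _, _, _⟩, 4, h =>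
    simp only [ascends, Nat.blt_eq] at h
    simp only [cross, inversions, if_neg h]
    omega
  | ⟨_, _, _, _, _⟩, _ + 5, _ => exact le_rfl

theorem inversions_foldl_cross_le (w : List ℕ) (l : Wires) :
    (w.foldl cross l).inversions ≤ l.inversions + w.length := by
  induction w generalizing l with
  | nil => simp
  | cons a w ih =>
    have hw := ih (l.cross a)
    rw [List.foldl_cons, List.length_cons]
    by_cases h : l.ascends a
    · have := inversions_cross_of_ascends h
      omega
    · have := inversions_cross_le_of_not_ascends h
      omega

theorem mem_reversingWords {k : ℕ} {l : Wires} (h : l.inversions + k = 10) (w : List ℕ) :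
    w ∈ reversingWords k l ↔
      w.length = k ∧ (∀ a ∈ w, 1 ≤ a ∧ a ≤ 4) ∧ w.foldl cross l = ⟨5, 4, 3, 2, 1⟩ := by
  induction k generalizing l w with
  | zero =>
    rw [reversingWords, List.length_eq_zero_iff]
    split_ifs with hl
    · simp +contextual [hl]
    · simp only [List.not_mem_nil, false_iff]
      rintro ⟨rfl, -, h'⟩
      exact hl h'
  | succ k ih =>
    cases w with
    | nil => simp [reversingWords]
    | cons a w =>
      have hmem : a :: w ∈ reversingWords (k + 1) l ↔
          (1 ≤ a ∧ a ≤ 4) ∧ l.ascends a ∧ w ∈ reversingWords k (l.cross a) := by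
        have ha : a ∈ [1, 2, 3, 4] ↔ 1 ≤ a ∧ a ≤ 4 := by
          simp only [List.mem_cons, List.not_mem_nil, or_false]
          omega
        simp only [reversingWords, eval_eq, List.mem_flatMap, List.mem_filter, List.mem_map,
          List.cons.injEq]
        rw [← ha]
        constructor
        · rintro ⟨b, ⟨hb, hb'⟩, v, hv, rfl, rfl⟩
          exact ⟨hb, hb', hv⟩
        · rintro ⟨hb, hb', hv⟩
          exact ⟨a, ⟨hb, hb'⟩, w, hv, rfl, rfl⟩
      rw [hmem, List.forall_mem_cons, List.foldl_cons, List.length_cons, Nat.add_right_cancel_iff]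
      by_cases hasc : l.ascends a
      · have := inversions_cross_of_ascends hasc
        rw [ih (by omega)]
        tauto
      · simp only [hasc, Bool.false_eq_true, false_and, and_false, false_iff]
        rintro ⟨hlen, -, hrev⟩
        have h₁ := inversions_foldl_cross_le w (l.cross a)
        have h₂ := inversions_cross_le_of_not_ascends hasc
        have h₃ : (⟨5, 4, 3, 2, 1⟩ : Wires).inversions = 10 := rfl
        rw [hrev] at h₁
        omega

theorem nodup_reversingWords (k : ℕ) (l : Wires) : (reversingWords k l).Nodup := by
  induction k generalizing l with
  | zero => rw [reversingWords]; split_ifs <;> simp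
  | succ k ih =>
    rw [reversingWords, List.nodup_flatMap]
    refine ⟨fun a _ => (ih _).map (List.cons_injective), ?_⟩
    refine List.Pairwise.imp ?_ (List.Nodup.filter _ (by decide : [1, 2, 3, 4].Nodup))
    intro a b hab
    simp only [Function.onFun, List.disjoint_left, List.mem_map]
    rintro _ ⟨v, -, rfl⟩ ⟨u, -, h⟩
    exact hab (List.cons.inj h).1.symm

end Wires

open Wires

theorem prod_adjTransposition_apply_of_notMem {w : List ℕ} (hw : ∀ a ∈ w, 1 ≤ a ∧ a ≤ 4)
    {x : ℕ} (hx : ¬ (1 ≤ x ∧ x ≤ 5)) : (w.map adjTransposition).prod x = x := by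
  induction w with
  | nil => simp
  | cons a w ih =>
    rw [List.forall_mem_cons] at hw
    rw [List.map_cons, List.prod_cons, Equiv.Perm.mul_apply, ih hw.2, adjTransposition]
    exact Equiv.swap_apply_of_ne_of_ne (by omega) (by omega)

theorem prod_eq_longWord_iff {w : List ℕ} (hw : ∀ a ∈ w, 1 ≤ a ∧ a ≤ 4) :
    (w.map adjTransposition).prod = longWord 5 ↔
      w.foldl cross ⟨1, 2, 3, 4, 5⟩ = ⟨5, 4, 3, 2, 1⟩ := by
  have h := ofPerm_mul_prod w hw 1
  rw [one_mul] at h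
  change _ = w.foldl cross ⟨1, 2, 3, 4, 5⟩ at h
  rw [← h]
  constructor
  · intro h'
    rw [h']
    rfl
  · intro h'
    simp only [ofPerm, Wires.mk.injEq] at h'
    obtain ⟨h₁, h₂, h₃, h₄, h₅⟩ := h'
    ext x
    by_cases hx : 1 ≤ x ∧ x ≤ 5
    · obtain ⟨hx₁, hx₅⟩ := hx
      interval_cases x <;> simp [longWord, *]
    · rw [prod_adjTransposition_apply_of_notMem hw hx]
      simp [longWord, hx]

theorem isReducedWord_five_iff (w : List ℕ) :
    IsReducedWord 5 w ↔ w ∈ reversingWords 10 ⟨1, 2, 3, 4, 5⟩ := by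
  rw [mem_reversingWords rfl, IsReducedWord]
  refine and_congr Iff.rfl (and_congr_right fun hw => prod_eq_longWord_iff hw)

theorem ite_cross_eq_letter {π : Equiv.Perm ℕ} (i : ℕ)
    (hπ : ∀ x, 1 ≤ x ∧ x ≤ 5 → 1 ≤ π x ∧ π x ≤ 5) {a : ℕ} (ha : 1 ≤ a ∧ a ≤ 4) :
    (if π a ∈ (Finset.Icc 1 5).erase i ∧ π (a + 1) ∈ (Finset.Icc 1 5).erase i
      then [((Finset.Icc 1 a).filter (fun p => π p ∈ (Finset.Icc 1 5).erase i)).card]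
      else []) = (ofPerm π).letter i a := by
  have key : ∀ x, 1 ≤ x ∧ x ≤ 5 → (π x ∈ (Finset.Icc 1 5).erase i ↔ π x ≠ i) := fun x hx => by
    simp [hπ x hx]
  have h₁ := key 1 (by decide)
  have h₂ := key 2 (by decide)
  have h₃ := key 3 (by decide)
  have h₄ := key 4 (by decide)
  have h₅ := key 5 (by decide)
  obtain ⟨ha₁, ha₂⟩ := ha
  interval_cases a <;> simp only [Finset.card_filter, Nat.reduceAdd, letter, ofPerm,
    Finset.sum_Icc_succ_top, Nat.one_le_ofNat, Finset.Icc_self,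
    Finset.sum_singleton, h₁, h₂, h₃, h₄, h₅] <;>
  · refine if_ctx_congr Iff.rfl (fun h => ?_) fun _ => rfl
    simp [h.1]

theorem inducedAux_erase_eq {w : List ℕ} (hw : ∀ a ∈ w, 1 ≤ a ∧ a ≤ 4) (i : ℕ)
    {π : Equiv.Perm ℕ} (hπ : ∀ x, 1 ≤ x ∧ x ≤ 5 → 1 ≤ π x ∧ π x ≤ 5) :
    inducedAux ((Finset.Icc 1 5).erase i) w π = induced i w (ofPerm π) := by
  induction w generalizing π with
  | nil => rfl
  | cons a w ih =>
    rw [List.forall_mem_cons] at hw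
    rw [inducedAux, induced, eval_eq, ite_cross_eq_letter i hπ hw.1, ih hw.2,
      ofPerm_mul_adjTransposition π hw.1]
    intro x hx
    refine hπ _ ?_
    rw [adjTransposition, Equiv.swap_apply_def]
    split_ifs <;> omega

theorem subset_Icc_card_four_iff (A : Finset ℕ) :
    A ⊆ Finset.Icc 1 5 ∧ A.card = 4 ↔ ∃ i ∈ Finset.Icc 1 5, (Finset.Icc 1 5).erase i = A := by
  constructor
  · rintro ⟨hA, hcard⟩
    obtain ⟨i, hi, h⟩ := (Finset.covBy_iff_exists_erase (s := A) (t := Finset.Icc 1 5)).mp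
      (Finset.covBy_iff_card_sdiff_eq_one.mpr ⟨hA, by simp [Finset.card_sdiff_of_subset hA, hcard]⟩)
    exact ⟨i, hi, h⟩
  · rintro ⟨i, hi, rfl⟩
    exact ⟨Finset.erase_subset _ _, by simp [Finset.card_erase_of_mem hi]⟩

/-- The reduced words for the long word in `S₅`, each paired with a deleted wire, whose induced
word is reentrant. -/
def reentrantPairs : List (List ℕ × ℕ) :=
  ([1, 2, 3, 4, 5].product
    [[1, 2, 3, 2, 1, 2], [3, 2, 1, 2, 3, 2], [2, 1, 2, 3, 2, 1], [2, 3, 2, 1, 2, 3]]).flatMap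
  fun q => ((reversingWords 10 ⟨1, 2, 3, 4, 5⟩).filter
    fun w => induced q.1 w ⟨1, 2, 3, 4, 5⟩ = q.2).map fun w => (w, q.1)

theorem length_reentrantPairs : reentrantPairs.length = 960 := by
  simp only [reentrantPairs, List.length_flatMap, List.length_map, ← List.countP_eq_length_filter,
    ← countInduced_eq]
  decide +kernel

theorem length_reversingWords : (reversingWords 10 ⟨1, 2, 3, 4, 5⟩).length = 768 := by
  decide +kernel

theorem nodup_reentrantPairs : reentrantPairs.Nodup := by
  refine List.nodup_flatMap.mpr ⟨fun q _ => ((nodup_reversingWords _ _).filter _).map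
    (Prod.mk_left_injective _), List.Pairwise.imp ?_ (List.Nodup.product (by decide) (by decide))⟩
  rintro ⟨i, x⟩ ⟨j, y⟩ hne
  simp only [Function.onFun, List.disjoint_left, List.mem_map, List.mem_filter,
    decide_eq_true_eq]
  rintro _ ⟨w, ⟨-, rfl⟩, rfl⟩ ⟨v, ⟨-, rfl⟩, h⟩
  obtain ⟨rfl, rfl⟩ := Prod.mk.inj h
  exact hne rfl

theorem mem_reentrantPairs (p : List ℕ × ℕ) :
    p ∈ reentrantPairs ↔ IsReducedWord 5 p.1 ∧ p.2 ∈ Finset.Icc 1 5 ∧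
      inducedWord p.1 ((Finset.Icc 1 5).erase p.2) ∈ reentrantSet := by
  obtain ⟨w, i⟩ := p
  have hi : i ∈ [1, 2, 3, 4, 5] ↔ i ∈ Finset.Icc 1 5 := by
    simp only [List.mem_cons, List.not_mem_nil, or_false, Finset.mem_Icc]
    omega
  have hX (x : List ℕ) : x ∈ [[1, 2, 3, 2, 1, 2], [3, 2, 1, 2, 3, 2], [2, 1, 2, 3, 2, 1],
      [2, 3, 2, 1, 2, 3]] ↔ x ∈ reentrantSet := by
    simp [reentrantSet]
  have hind (hw : IsReducedWord 5 w) : inducedWord w ((Finset.Icc 1 5).erase i) =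
      induced i w ⟨1, 2, 3, 4, 5⟩ :=
    inducedAux_erase_eq hw.2.1 i (by simp)
  simp only [reentrantPairs, List.mem_flatMap, List.mem_map, List.mem_filter,
    ← isReducedWord_five_iff, decide_eq_true_eq, Prod.exists, List.pair_mem_product, hX,
    Prod.mk.injEq]
  constructor
  · rintro ⟨j, x, ⟨hj, hx⟩, v, ⟨hv, rfl⟩, rfl, rfl⟩
    exact ⟨hv, hi.mp hj, (hind hv).symm ▸ hx⟩
  · rintro ⟨hw, hj, hx⟩
    exact ⟨i, _, ⟨hi.mpr hj, hind hw ▸ hx⟩, w, ⟨hw, rfl⟩, rfl, rfl⟩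

/-- The number of pairs `(w, A)` with `w` a reduced word for the long word in `S₅`
and `A` a 4-element subset of `{1,…,5}` whose induced word is reentrant is `960`;
consequently, with `768` reduced words in total, the probability of a reentrant
induced word is `960 / (C(5,4) * 768) = 1/4`. -/
theorem reentrant_pairs_S5_count :
    Nat.card {p : List ℕ × Finset ℕ //
        IsReducedWord 5 p.1 ∧ p.2 ⊆ Finset.Icc 1 5 ∧ p.2.card = 4 ∧
          inducedWord p.1 p.2 ∈ reentrantSet} = 960 ∧
    Nat.card {w : List ℕ // IsReducedWord 5 w} = 768 ∧
    (960 : ℚ) / (Nat.choose 5 4 * 768) = 1 / 4 := by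
  refine ⟨?_, ?_, by norm_num [Nat.choose]⟩
  · have hinj : Set.InjOn (fun p : List ℕ × ℕ => (p.1, (Finset.Icc 1 5).erase p.2))
        reentrantPairs.toFinset := by
      rintro ⟨w, i⟩ hp ⟨v, j⟩ - h
      rw [List.coe_toFinset, Set.mem_ofPred_eq, mem_reentrantPairs] at hp
      rw [Prod.mk.injEq] at h
      rw [Prod.mk.injEq]
      exact ⟨h.1, (Finset.erase_inj _ hp.2.1).mp h.2⟩
    rw [Nat.subtype_card (reentrantPairs.toFinset.image
        fun p => (p.1, (Finset.Icc 1 5).erase p.2)), Finset.card_image_of_injOn hinj,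
      List.toFinset_card_of_nodup nodup_reentrantPairs, length_reentrantPairs]
    rintro ⟨w, A⟩
    simp only [Finset.mem_image, List.mem_toFinset, mem_reentrantPairs, Prod.exists,
      Prod.mk.injEq]
    rw [← and_assoc (a := A ⊆ _), subset_Icc_card_four_iff]
    constructor
    · rintro ⟨v, i, ⟨hw, hi, h⟩, rfl, rfl⟩
      exact ⟨hw, ⟨i, hi, rfl⟩, h⟩
    · rintro ⟨hw, ⟨i, hi, rfl⟩, h⟩
      exact ⟨w, i, ⟨hw, hi, h⟩, rfl, rfl⟩
  · rw [Nat.subtype_card (reversingWords 10 ⟨1, 2, 3, 4, 5⟩).toFinset,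
      List.toFinset_card_of_nodup (nodup_reversingWords _ _), length_reversingWords]
    intro w
    rw [List.mem_toFinset, isReducedWord_five_iff]
end

section
/- The number of reduced words for the long word w0 = [6,5,4,3,2,1] in S_6 is exactly 292,864. -/
/-- The lists obtained from `p` by swapping two adjacent entries. -/
def adjacentSwaps : List ℕ → List (List ℕ)
  | [] => []
  | [_] => []
  | x :: y :: l => (y :: x :: l) :: (adjacentSwaps (y :: l)).map (x :: ·)

/-- The lists obtained from `p` by swapping two adjacent entries that are in increasing order. -/
def ascentSwaps : List ℕ → List (List ℕ)
  | [] => []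
  | [_] => []
  | x :: y :: l =>
      (if x < y then [y :: x :: l] else []) ++ (ascentSwaps (y :: l)).map (x :: ·)

/-- The number of inversions of a list. -/
def inversions : List ℕ → ℕ
  | [] => 0
  | x :: l => l.countP (· < x) + inversions l

/-- The number of sequences of `k` adjacent swaps leading from `p` to `t`. -/
def swapPaths (t : List ℕ) : ℕ → List ℕ → ℕ
  | 0, p => if p = t then 1 else 0
  | k + 1, p => ((adjacentSwaps p).map (swapPaths t k)).sum

/-- The number of sequences of `k` adjacent swaps leading from `p` to `t`, each of which swaps
entries that are in increasing order. -/
def ascentPaths (t : List ℕ) : ℕ → List ℕ → ℕ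
  | 0, p => if p = t then 1 else 0
  | k + 1, p => ((ascentSwaps p).map (ascentPaths t k)).sum

theorem perm_of_mem_adjacentSwaps {p q : List ℕ} (h : q ∈ adjacentSwaps p) : q.Perm p := by
  induction p using adjacentSwaps.induct generalizing q with
  | case1 => simp [adjacentSwaps] at h
  | case2 => simp [adjacentSwaps] at h
  | case3 x y l ih =>
    simp only [adjacentSwaps, List.mem_cons, List.mem_map] at h
    rcases h with rfl | ⟨r, hr, rfl⟩
    · exact List.Perm.swap ..
    · exact (ih hr).cons x

theorem inversions_le_of_mem_adjacentSwaps {p q : List ℕ} (h : q ∈ adjacentSwaps p) :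
    inversions q ≤ inversions p + 1 := by
  induction p using adjacentSwaps.induct generalizing q with
  | case1 => simp [adjacentSwaps] at h
  | case2 => simp [adjacentSwaps] at h
  | case3 x y l ih =>
    simp only [adjacentSwaps, List.mem_cons, List.mem_map] at h
    rcases h with rfl | ⟨r, hr, rfl⟩
    · simp only [inversions, List.countP_cons, decide_eq_true_eq]
      split_ifs <;> omega
    · have h₁ := ih hr
      have h₂ := (perm_of_mem_adjacentSwaps hr).countP_eq (· < x)
      rw [inversions, inversions, h₂]
      omega

theorem swapPaths_eq_zero {t p : List ℕ} {k : ℕ} (h : inversions p + k < inversions t) :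
    swapPaths t k p = 0 := by
  induction k generalizing p with
  | zero =>
    have : p ≠ t := by rintro rfl; omega
    simp [swapPaths, this]
  | succ k ih =>
    rw [swapPaths, List.sum_eq_zero]
    intro n hn
    obtain ⟨q, hq, rfl⟩ := List.mem_map.1 hn
    have := inversions_le_of_mem_adjacentSwaps hq
    exact ih (by omega)

theorem sum_adjacentSwaps {f : List ℕ → ℕ} {p : List ℕ}
    (hf : ∀ q, inversions q ≤ inversions p → q.Perm p → f q = 0) :
    ((adjacentSwaps p).map f).sum = ((ascentSwaps p).map f).sum := by
  induction p using adjacentSwaps.induct generalizing f with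
  | case1 => rfl
  | case2 => rfl
  | case3 x y l ih =>
    have htail := @ih (fun q => f (x :: q)) fun q hq hp => by
      refine hf _ ?_ (hp.cons x)
      rw [inversions, inversions, hp.countP_eq]
      omega
    simp only [adjacentSwaps, ascentSwaps, List.map_cons, List.sum_cons, List.map_append,
      List.sum_append, List.map_map]
    congr 1
    split_ifs with h
    · simp
    · refine hf _ ?_ (List.Perm.swap ..)
      simp only [inversions, List.countP_cons, decide_eq_true_eq]
      split_ifs <;> omega

theorem inversions_of_mem_ascentSwaps {p q : List ℕ} (h : q ∈ ascentSwaps p) :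
    q.Perm p ∧ inversions q = inversions p + 1 := by
  induction p using adjacentSwaps.induct generalizing q with
  | case1 => simp [ascentSwaps] at h
  | case2 => simp [ascentSwaps] at h
  | case3 x y l ih =>
    simp only [ascentSwaps, List.mem_append, List.mem_map] at h
    rcases h with h | ⟨r, hr, rfl⟩
    · split_ifs at h with hxy
      · obtain rfl := List.mem_singleton.1 h
        refine ⟨List.Perm.swap .., ?_⟩
        simp only [inversions, List.countP_cons, decide_eq_true_eq]
        split_ifs <;> omega
      · simp at h
    · obtain ⟨hp, hi⟩ := ih hr
      refine ⟨hp.cons x, ?_⟩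
      rw [inversions, inversions, hp.countP_eq, hi]
      omega

theorem swapPaths_eq_ascentPaths {t p : List ℕ} {k : ℕ} (h : inversions p + k ≤ inversions t) :
    swapPaths t k p = ascentPaths t k p := by
  induction k generalizing p with
  | zero => rfl
  | succ k ih =>
    rw [swapPaths, ascentPaths,
      sum_adjacentSwaps fun q hq _ => swapPaths_eq_zero (by omega)]
    congr 1
    refine List.map_congr_left fun q hq => ih ?_
    have := (inversions_of_mem_ascentSwaps hq).2
    omega

/-- A finite multiset of lists, stored as a trie: `nil n` holds `n` copies of the empty list, and
`branch x c r` holds the lists in `c` with `x` prepended, together with the lists in `r`. -/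
inductive ListTrie
  | nil (n : ℕ)
  | branch (x : ℕ) (child rest : ListTrie)

namespace ListTrie

/-- The sum of `f` over the lists in a trie, with multiplicity. -/
def weight : ListTrie → (List ℕ → ℕ) → ℕ
  | nil n, f => n * f []
  | branch x c r, f => weight c (fun p => f (x :: p)) + weight r f

/-- Add `n` copies of the empty list. -/
def addNil (n : ℕ) : ListTrie → ListTrie
  | nil k => nil (n + k)
  | branch x c r => branch x c (addNil n r)

/-- Add the lists in `c` with `x` prepended, using `m` to merge `c` with an existing branch. -/
def addBranch (x : ℕ) (c : ListTrie) (m : ListTrie → ListTrie) : ListTrie → ListTrie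
  | nil n => branch x c (nil n)
  | branch y d r =>
      bif Nat.beq x y then branch y (m d) r else branch y d (addBranch x c m r)

/-- The union of two multisets of lists. -/
def merge : ListTrie → ListTrie → ListTrie
  | nil n, t => addNil n t
  | branch x c r, t => addBranch x c (merge c) (merge r t)

/-- Add the lists in `c` with `x` prepended, avoiding an empty branch. -/
def addChild (x : ℕ) : ListTrie → ListTrie → ListTrie
  | nil 0, t => t
  | c, t => addBranch x c (merge c) t

/-- Add the lists `y :: x :: l` for all lists `y :: l` in the trie with `x < y`. -/
def addSwaps (x : ℕ) : ListTrie → ListTrie → ListTrie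
  | nil _, t => t
  | branch y d r, t =>
      bif Nat.blt x y then merge (branch y (branch x d (nil 0)) (nil 0)) (addSwaps x r t)
      else addSwaps x r t

/-- Replace every list by its `ascentSwaps`. -/
def step : ListTrie → ListTrie
  | nil _ => nil 0
  | branch x c r => addSwaps x c (addChild x (step c) (step r))

theorem weight_addNil (n : ℕ) (t : ListTrie) (f : List ℕ → ℕ) :
    (addNil n t).weight f = n * f [] + t.weight f := by
  induction t with
  | nil k => simp only [addNil, weight]; ring
  | branch x c r _ ih => simp only [addNil, weight, ih]; ring

theorem weight_addBranch {c : ListTrie} {m : ListTrie → ListTrie}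
    (hm : ∀ d f, (m d).weight f = c.weight f + d.weight f) (x : ℕ) (t : ListTrie)
    (f : List ℕ → ℕ) :
    (addBranch x c m t).weight f = c.weight (fun p => f (x :: p)) + t.weight f := by
  induction t with
  | nil k => rfl
  | branch y d r _ ih =>
    rw [addBranch]
    by_cases h : x = y
    · subst h
      rw [Nat.beq_refl, cond_true, weight, weight, hm, add_assoc]
    · rw [Bool.eq_false_iff.2 (fun hb => h (Nat.eq_of_beq_eq_true hb)), cond_false, weight,
        weight, ih]
      ring

theorem weight_merge (s t : ListTrie) (f : List ℕ → ℕ) :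
    (merge s t).weight f = s.weight f + t.weight f := by
  induction s generalizing t f with
  | nil n => exact weight_addNil n t f
  | branch x c r ihc ihr => rw [merge, weight_addBranch ihc, ihr, weight, add_assoc]

theorem weight_addChild (x : ℕ) (c t : ListTrie) (f : List ℕ → ℕ) :
    (addChild x c t).weight f = c.weight (fun p => f (x :: p)) + t.weight f := by
  unfold addChild
  split
  · simp [weight]
  · exact weight_addBranch (weight_merge _) x t f

theorem weight_addSwaps (x : ℕ) (c t : ListTrie) (f : List ℕ → ℕ) :
    (addSwaps x c t).weight f + c.weight (fun p => ((ascentSwaps p).map fun q => f (x :: q)).sum) =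
      c.weight (fun p => ((ascentSwaps (x :: p)).map f).sum) + t.weight f := by
  induction c with
  | nil n => simp [addSwaps, weight, ascentSwaps]
  | branch y d r _ ih =>
    have hadd (d : ListTrie) (g h : List ℕ → ℕ) :
        d.weight (fun p => g p + h p) = d.weight g + d.weight h := by
      induction d generalizing g h with
      | nil n => simp only [weight]; ring
      | branch z d r ihd ihr => simp only [weight, ihd, ihr]; ring
    have hz (d : ListTrie) : d.weight (fun _ => 0) = 0 := by
      induction d with
      | nil n => rfl
      | branch z d r ihd ihr => simp only [weight, ihd, ihr]
    rw [addSwaps]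
    by_cases h : x < y
    · rw [show Nat.blt x y = true by rwa [Nat.blt_eq], cond_true, weight_merge]
      simp only [weight, ascentSwaps, if_pos h, List.map_append, List.sum_append, List.map_cons,
        List.map_nil, List.sum_cons, List.sum_nil, List.map_map, hadd, hz, Function.comp_def]
      linarith
    · rw [show Nat.blt x y = false by rwa [Bool.eq_false_iff, ne_eq, Nat.blt_eq], cond_false]
      simp only [weight, ascentSwaps, if_neg h, List.nil_append, List.map_map, Function.comp_def]
      linarith

theorem weight_step (t : ListTrie) (f : List ℕ → ℕ) :
    t.step.weight f = t.weight (fun p => ((ascentSwaps p).map f).sum) := by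
  induction t generalizing f with
  | nil n => simp [step, weight, ascentSwaps]
  | branch x c r ihc ihr =>
    have h := weight_addSwaps x c (addChild x c.step r.step) f
    rw [weight_addChild, ihc, ihr] at h
    rw [step, weight]
    omega

theorem weight_iterate_step (t : List ℕ) (k : ℕ) (s : ListTrie) :
    (step^[k] s).weight (ascentPaths t 0) = s.weight (ascentPaths t k) := by
  induction k generalizing s with
  | zero => rfl
  | succ k ih =>
    rw [Function.iterate_succ_apply, ih, weight_step]
    rfl

/-- The trie holding a single list. -/
def single : List ℕ → ListTrie
  | [] => nil 1
  | x :: l => branch x (single l) (nil 0)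

theorem weight_single (p : List ℕ) (f : List ℕ → ℕ) : (single p).weight f = f p := by
  induction p generalizing f with
  | nil => simp [single, weight]
  | cons x l ih => simp [single, weight, ih]

end ListTrie

theorem ascentPaths_fifteen :
    ascentPaths [6, 5, 4, 3, 2, 1] 15 [1, 2, 3, 4, 5, 6] = 292864 := by
  rw [← ListTrie.weight_single _ (ascentPaths _ _), ← ListTrie.weight_iterate_step]
  decide +kernel

/-- The one-line notation of a permutation on `{1, …, 6}`. -/
def oneLine (π : Equiv.Perm ℕ) : List ℕ := [π 1, π 2, π 3, π 4, π 5, π 6]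

/-- The words of length `k` in the letters `{1, …, 5}` that lead from `π` to the long word. -/
def WordsFrom (k : ℕ) (π : Equiv.Perm ℕ) : Type :=
  {w : List ℕ // w.length = k ∧ (∀ a ∈ w, 1 ≤ a ∧ a ≤ 5) ∧
    π * (w.map adjTransposition).prod = longWord 6}

theorem longWord_six_apply (i : ℕ) :
    longWord 6 i = if 1 ≤ i ∧ i ≤ 6 then 6 + 1 - i else i := rfl

theorem oneLine_eq_iff {π : Equiv.Perm ℕ} (hπ : ∀ i, ¬(1 ≤ i ∧ i ≤ 6) → π i = i) :
    oneLine π = [6, 5, 4, 3, 2, 1] ↔ π = longWord 6 := by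
  constructor
  · intro h
    simp only [oneLine, List.cons.injEq, and_true] at h
    obtain ⟨h1, h2, h3, h4, h5, h6⟩ := h
    ext i
    rw [longWord_six_apply]
    split_ifs with hi
    · obtain ⟨hl, hu⟩ := hi
      interval_cases i <;> simpa
    · exact hπ i hi
  · rintro rfl
    simp [oneLine, longWord_six_apply]

theorem sum_swapPaths_oneLine (t : List ℕ) (k : ℕ) (π : Equiv.Perm ℕ) :
    ∑ a : Fin 5, swapPaths t k (oneLine (π * adjTransposition (a + 1))) =
      swapPaths t (k + 1) (oneLine π) := by
  simp [Fin.sum_univ_five, swapPaths, oneLine, adjacentSwaps, adjTransposition,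
    Equiv.swap_apply_def, add_assoc]

/-- Prepending a letter to a word. -/
def WordsFrom.cons {k : ℕ} {π : Equiv.Perm ℕ}
    (x : Σ a : Fin 5, WordsFrom k (π * adjTransposition (a + 1))) : WordsFrom (k + 1) π :=
  ⟨(x.1 + 1 : ℕ) :: x.2.1, by simp [x.2.2.1], by
    intro b hb
    rcases List.mem_cons.1 hb with rfl | hb
    · have := x.1.isLt
      omega
    · exact x.2.2.2.1 b hb, by
    rw [List.map_cons, List.prod_cons, ← mul_assoc]
    exact x.2.2.2.2⟩

theorem WordsFrom.cons_bijective (k : ℕ) (π : Equiv.Perm ℕ) :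
    Function.Bijective (WordsFrom.cons (k := k) (π := π)) := by
  constructor
  · rintro ⟨a, w, hw⟩ ⟨b, v, hv⟩ h
    have h' := congrArg Subtype.val h
    simp only [WordsFrom.cons, List.cons.injEq, Nat.add_right_cancel_iff] at h'
    obtain ⟨h₁, rfl⟩ := h'
    obtain rfl := Fin.ext h₁
    rfl
  · rintro ⟨w, hl, hm, hp⟩
    cases w with
    | nil => simp at hl
    | cons b w =>
      have hb := hm b List.mem_cons_self
      obtain ⟨a, rfl⟩ : ∃ a, b = a + 1 := ⟨b - 1, by omega⟩
      refine ⟨⟨⟨a, by omega⟩, w, by simpa using hl,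
        fun c hc => hm c (List.mem_cons_of_mem _ hc), ?_⟩, rfl⟩
      rw [List.map_cons, List.prod_cons, ← mul_assoc] at hp
      exact hp

theorem card_wordsFrom (k : ℕ) {π : Equiv.Perm ℕ} (hπ : ∀ i, ¬(1 ≤ i ∧ i ≤ 6) → π i = i) :
    Finite (WordsFrom k π) ∧
      Nat.card (WordsFrom k π) = swapPaths [6, 5, 4, 3, 2, 1] k (oneLine π) := by
  induction k generalizing π with
  | zero =>
    have hsub : Subsingleton (WordsFrom 0 π) :=
      ⟨fun v w => Subtype.ext <| by
        rw [List.eq_nil_of_length_eq_zero v.2.1, List.eq_nil_of_length_eq_zero w.2.1]⟩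
    refine ⟨inferInstance, ?_⟩
    rw [swapPaths]
    split_ifs with h
    · have : Nonempty (WordsFrom 0 π) :=
        ⟨⟨[], rfl, by simp, by simpa using (oneLine_eq_iff hπ).1 h⟩⟩
      exact Nat.card_eq_one_iff_unique.2 ⟨hsub, this⟩
    · have : IsEmpty (WordsFrom 0 π) := by
        refine ⟨fun w => h ((oneLine_eq_iff hπ).2 ?_)⟩
        have hw := w.2.2.2
        rwa [List.eq_nil_of_length_eq_zero w.2.1, List.map_nil, List.prod_nil, mul_one] at hw
      exact Nat.card_of_isEmpty
  | succ k ih =>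
    have ih' (a : Fin 5) := @ih (π * adjTransposition (a + 1)) fun i hi => by
      rw [Equiv.Perm.mul_apply, adjTransposition,
        Equiv.swap_apply_of_ne_of_ne (by omega) (by omega), hπ i hi]
    have (a : Fin 5) := (ih' a).1
    refine ⟨Finite.of_surjective _ (WordsFrom.cons_bijective k π).2, ?_⟩
    rw [← Nat.card_congr (Equiv.ofBijective _ (WordsFrom.cons_bijective k π)), Nat.card_sigma,
      ← sum_swapPaths_oneLine]
    exact Finset.sum_congr rfl fun a _ => (ih' a).2

/-- The number of reduced words for the long word `[6,5,4,3,2,1]` in `S₆` is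
`292864`. -/
theorem reduced_words_S6_count :
    Nat.card {w : List ℕ // IsReducedWord 6 w} = 292864 := by
  have e : {w : List ℕ // IsReducedWord 6 w} ≃ WordsFrom 15 1 :=
    Equiv.subtypeEquivRight fun w => by
      rw [one_mul]
      rfl
  rw [Nat.card_congr e, (card_wordsFrom 15 (fun _ _ => rfl)).2, ← ascentPaths_fifteen]
  exact swapPaths_eq_ascentPaths (by decide)
end

section
/- The number of pairs (w, A), where w is a reduced word for the long word w0 in S_6 and A is a 4-element subset of {1,...,6} such that the induced word of w on A belongs to the reentrant set X, is exactly 1,098,240. Consequently, since there are 292,864 reduced words for w0 in S_6, the probability that a uniformly random such pair has reentrant induced word is 1,098,240/(C(6,4)·292,864) = 1/4. -/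
/-!
Reduced words are counted by dynamic programming over the weak order. A state is a single number:
its six lowest base-8 digits are the wires in positions `1, …, 6`, and the remaining part encodes,
in base 4, the induced letters still to be recorded. A table lists states with multiplicities.
-/

namespace Reentrant

/-- `f n`, arranged so that kernel reduction evaluates `n` to a literal first. -/
def evalAt {α : Type} (f : ℕ → α) : ℕ → α
  | 0 => f 0
  | k + 1 => f (k + 1)

/-- The binary digit of the mask `m` at `x`. -/
def memb (m x : ℕ) : ℕ := m / Nat.pow 2 x % 2

/-- The number of the first `a` base-8 digits of `n` that belong to the mask `m`. -/
def rank (m n : ℕ) : ℕ → ℕ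
  | 0 => 0
  | a + 1 => memb m (n % 8) + rank m (n / 8) a

/-- Drop the first of the induced letters still to be recorded. -/
def popped (n : ℕ) : ℕ := n % 262144 + 262144 * (n / 1048576)

/-- The state after crossing wires `x` and `y` at the digits of `n` of weight `p = 8 ^ a` and
`8 * p`; there is none if the crossing is a descent or records a wrong letter. -/
def cross (m n a p x y : ℕ) : Option ℕ :=
  bif Nat.ble y x then none else
    bif Nat.beq (memb m x + memb m y) 2 then
      bif Nat.beq (n / 262144 % 4) (rank m n (a + 1)) then some (popped (n - 7 * p * (y - x)))
      else none
    else some (n - 7 * p * (y - x))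

/-- The state after the letter `a + 1`, where `p = 8 ^ a`. -/
def step (m n a p : ℕ) : Option ℕ := cross m n a p (n / p % 8) (n / (8 * p) % 8)

/-- Add the state `n` with multiplicity `c` to a table. It uses `List.rec` directly because this
reduces much faster in the kernel than a definition by structural recursion. -/
def bump (n c : ℕ) (t : List (ℕ × ℕ)) : List (ℕ × ℕ) :=
  List.rec [(n, c)]
    (fun p t ih => bif Nat.beq n p.1 then evalAt (fun c => (n, c) :: t) (c + p.2) else p :: ih) t

def push (m n c a p : ℕ) (t : List (ℕ × ℕ)) : List (ℕ × ℕ) :=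
  match step m n a p with
  | none => t
  | some n' => evalAt (fun n' => bump n' c t) n'

def pushAll (m n c : ℕ) (t : List (ℕ × ℕ)) : List (ℕ × ℕ) :=
  push m n c 0 1 (push m n c 1 8 (push m n c 2 64 (push m n c 3 512 (push m n c 4 4096 t))))

/-- The table of all successors of the states in a table. -/
def advance (m : ℕ) : List (ℕ × ℕ) → List (ℕ × ℕ)
  | [] => []
  | (n, c) :: t => pushAll m n c (advance m t)

/-- The number of `k`-step paths from a table to the state of the long word. -/
def total (m : ℕ) : ℕ → List (ℕ × ℕ) → ℕ
  | 0, t => (t.map fun p => bif Nat.beq p.1 42798 then p.2 else 0).sum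
  | k + 1, t => total m k (advance m t)

/-- The base-4 number whose digits are the letters of `r`. -/
def pack : List ℕ → ℕ
  | [] => 0
  | c :: r => c + 4 * pack r

/-- The state of the permutation `π` with `q` encoding the letters still to be recorded. -/
def code (π : Equiv.Perm ℕ) (q : ℕ) : ℕ :=
  π 1 + 8 * π 2 + 64 * π 3 + 512 * π 4 + 4096 * π 5 + 32768 * π 6 + 262144 * q

/-- The number of paths from one state, defined without tables. -/
def count (m : ℕ) : ℕ → ℕ → ℕ
  | 0, n => if n = 42798 then 1 else 0
  | k + 1, n => ∑ a ∈ Finset.range 5, (step m n a (8 ^ a)).elim 0 (count m k)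

/-- The sum of `f` over the states of a table. -/
def weight (f : ℕ → ℕ) (t : List (ℕ × ℕ)) : ℕ := (t.map fun p => p.2 * f p.1).sum

theorem evalAt_eq {α : Type} (f : ℕ → α) (n : ℕ) : evalAt f n = f n := by
  cases n <;> rfl

theorem weight_bump (f : ℕ → ℕ) (n c : ℕ) (t : List (ℕ × ℕ)) :
    weight f (bump n c t) = c * f n + weight f t := by
  induction t with
  | nil => simp [bump, weight]
  | cons p t ih =>
    have h : bump n c (p :: t) =
      bif Nat.beq n p.1 then evalAt (fun c => (n, c) :: t) (c + p.2) else p :: bump n c t := rfl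
    rw [h, evalAt_eq]
    cases hb : Nat.beq n p.1 with
    | true =>
      obtain rfl := Nat.eq_of_beq_eq_true hb
      simp [weight]
      ring
    | false =>
      simp only [weight, cond_false, List.map_cons, List.sum_cons] at ih ⊢
      omega

theorem weight_push (f : ℕ → ℕ) (m n c a p : ℕ) (t : List (ℕ × ℕ)) :
    weight f (push m n c a p t) = c * (step m n a p).elim 0 f + weight f t := by
  unfold push
  cases step m n a p <;> simp [evalAt_eq, weight_bump]

theorem weight_advance (m k : ℕ) (t : List (ℕ × ℕ)) :
    weight (count m k) (advance m t) = weight (count m (k + 1)) t := by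
  induction t with
  | nil => rfl
  | cons p t ih =>
    have h : weight (count m (k + 1)) (p :: t) =
      p.2 * count m (k + 1) p.1 + weight (count m (k + 1)) t := by simp [weight]
    rw [h, ← ih]
    simp only [advance, pushAll, weight_push, count, Finset.sum_range_succ, Finset.sum_range_zero]
    norm_num
    ring

theorem total_eq_weight (m k : ℕ) (t : List (ℕ × ℕ)) : total m k t = weight (count m k) t := by
  induction k generalizing t with
  | zero =>
    simp only [total, weight, count]
    congr 2
    funext p
    by_cases h : p.1 = 42798
    · simp [h]
    · have hb : Nat.beq p.1 42798 = false := by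
        rw [← Bool.not_eq_true, Nat.beq_eq]
        exact h
      simp [h, hb]
  | succ k ih => rw [total, ih, weight_advance]

theorem total_singleton (m k n : ℕ) : total m k [(n, 1)] = count m k n := by
  simp [total_eq_weight, weight]

/-- The number of inversions of a list. -/
def inversions : List ℕ → ℕ
  | [] => 0
  | x :: l => l.countP (· < x) + inversions l

theorem inversions_swap {x y : ℕ} (h : x < y) (l₁ l₂ : List ℕ) :
    inversions (l₁ ++ y :: x :: l₂) = inversions (l₁ ++ x :: y :: l₂) + 1 := by
  induction l₁ with
  | nil =>
    simp [inversions, h, h.le]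
    omega
  | cons z l ih =>
    simp only [List.cons_append, inversions, ih, List.countP_append, List.countP_cons]
    omega

/-- The wires in positions `1, …, 6`. -/
def wires (π : Equiv.Perm ℕ) : List ℕ := [π 1, π 2, π 3, π 4, π 5, π 6]

theorem wires_mul_adjTransposition (π : Equiv.Perm ℕ) {a : ℕ} (h₁ : 1 ≤ a) (h₂ : a ≤ 5) :
    ∃ l₁ l₂, wires π = l₁ ++ π a :: π (a + 1) :: l₂ ∧
      wires (π * adjTransposition a) = l₁ ++ π (a + 1) :: π a :: l₂ := by
  interval_cases a
  · exact ⟨[], [π 3, π 4, π 5, π 6], rfl, rfl⟩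
  · exact ⟨[π 1], [π 4, π 5, π 6], rfl, rfl⟩
  · exact ⟨[π 1, π 2], [π 5, π 6], rfl, rfl⟩
  · exact ⟨[π 1, π 2, π 3], [π 6], rfl, rfl⟩
  · exact ⟨[π 1, π 2, π 3, π 4], [], rfl, rfl⟩

theorem inversions_ascent (π : Equiv.Perm ℕ) {a : ℕ} (h₁ : 1 ≤ a) (h₂ : a ≤ 5)
    (h : π a < π (a + 1)) :
    inversions (wires (π * adjTransposition a)) = inversions (wires π) + 1 := by
  obtain ⟨l₁, l₂, e₁, e₂⟩ := wires_mul_adjTransposition π h₁ h₂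
  rw [e₁, e₂, inversions_swap h]

theorem inversions_descent (π : Equiv.Perm ℕ) {a : ℕ} (h₁ : 1 ≤ a) (h₂ : a ≤ 5)
    (h : π (a + 1) ≤ π a) :
    inversions (wires (π * adjTransposition a)) ≤ inversions (wires π) := by
  obtain ⟨l₁, l₂, e₁, e₂⟩ := wires_mul_adjTransposition π h₁ h₂
  rw [e₁, e₂]
  rcases h.lt_or_eq with h | h
  · rw [inversions_swap h]
    omega
  · rw [h]

/-- The words of length `k` in the letters `1, …, 5`. -/
def words : ℕ → Finset (List ℕ)
  | 0 => {[]}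
  | k + 1 => (Finset.Icc 1 5).biUnion fun a => (words k).image (List.cons a)

theorem mem_words {k : ℕ} {w : List ℕ} :
    w ∈ words k ↔ w.length = k ∧ ∀ a ∈ w, 1 ≤ a ∧ a ≤ 5 := by
  induction k generalizing w with
  | zero => cases w <;> simp [words]
  | succ k ih =>
    cases w with
    | nil => simp [words]
    | cons a w => simp [words, ih]; tauto

theorem le_inversions_add {w : List ℕ} (hw : ∀ a ∈ w, 1 ≤ a ∧ a ≤ 5) {π : Equiv.Perm ℕ}
    (h : π * (w.map adjTransposition).prod = longWord 6) :
    15 ≤ inversions (wires π) + w.length := by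
  induction w generalizing π with
  | nil =>
    obtain rfl : π = longWord 6 := by simpa using h
    decide
  | cons a w ih =>
    have ha := hw a (by simp)
    have := ih (fun b hb => hw b (by simp [hb])) (π := π * adjTransposition a)
      (by simpa [mul_assoc] using h)
    rw [List.length_cons]
    rcases lt_or_ge (π a) (π (a + 1)) with hlt | hge
    · rw [inversions_ascent π ha.1 ha.2 hlt] at this
      omega
    · have := inversions_descent π ha.1 ha.2 hge
      omega

open Classical in
/-- The words of length `k` leading from `π` to the long word with induced word `r`. -/
noncomputable def paths (A : Finset ℕ) (k : ℕ) (π : Equiv.Perm ℕ) (r : List ℕ) : Finset (List ℕ) :=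
  (words k).filter fun w => π * (w.map adjTransposition).prod = longWord 6 ∧ inducedAux A w π = r

theorem mem_paths {A : Finset ℕ} {k : ℕ} {π : Equiv.Perm ℕ} {r w : List ℕ} :
    w ∈ paths A k π r ↔ w ∈ words k ∧
      π * (w.map adjTransposition).prod = longWord 6 ∧ inducedAux A w π = r := by
  simp [paths]

/-- The words `w` of length `k` such that `a :: w` leads from `π` to the long word with induced
word `r`. -/
noncomputable def continuations (A : Finset ℕ) (k a : ℕ) (π : Equiv.Perm ℕ) (r : List ℕ) :
    Finset (List ℕ) :=
  if π a ∈ A ∧ π (a + 1) ∈ A then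
    match r with
    | [] => ∅
    | c :: r =>
      if c = ((Finset.Icc 1 a).filter fun p => π p ∈ A).card then
        paths A k (π * adjTransposition a) r
      else ∅
  else paths A k (π * adjTransposition a) r

theorem mem_continuations {A : Finset ℕ} {k a : ℕ} {π : Equiv.Perm ℕ} {r w : List ℕ} :
    w ∈ continuations A k a π r ↔ w ∈ words k ∧
      π * adjTransposition a * (w.map adjTransposition).prod = longWord 6 ∧
        inducedAux A (a :: w) π = r := by
  rw [continuations.eq_def, inducedAux]
  by_cases hA : π a ∈ A ∧ π (a + 1) ∈ A
  · rw [if_pos hA, if_pos hA]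
    cases r with
    | nil => simp
    | cons c r =>
      dsimp only
      split_ifs with hc
      · simp [mem_paths, hc]
      · simp [Ne.symm hc]
  · rw [if_neg hA, if_neg hA, mem_paths, List.nil_append]

/-- `π` fixes everything outside `{1, …, 6}`. -/
def FixesOutside (π : Equiv.Perm ℕ) : Prop := ∀ i, i < 1 ∨ 6 < i → π i = i

theorem FixesOutside.bounds {π : Equiv.Perm ℕ} (hπ : FixesOutside π) {i : ℕ} (h₁ : 1 ≤ i)
    (h₂ : i ≤ 6) : 1 ≤ π i ∧ π i ≤ 6 := by
  by_contra h
  have := π.injective (hπ (π i) (by omega))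
  omega

theorem FixesOutside.mul_adjTransposition {π : Equiv.Perm ℕ} (hπ : FixesOutside π) {a : ℕ}
    (h₁ : 1 ≤ a) (h₂ : a ≤ 5) : FixesOutside (π * adjTransposition a) := by
  intro i hi
  rw [Equiv.Perm.mul_apply, adjTransposition,
    Equiv.swap_apply_of_ne_of_ne (by omega) (by omega), hπ i hi]

theorem code_digit {π : Equiv.Perm ℕ} (hπ : FixesOutside π) (q : ℕ) {i : ℕ} (hi : i < 6) :
    code π q / 8 ^ i % 8 = π (i + 1) := by
  have h₁ := hπ.bounds (i := 1) (by simp) (by simp)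
  have h₂ := hπ.bounds (i := 2) (by simp) (by simp)
  have h₃ := hπ.bounds (i := 3) (by simp) (by simp)
  have h₄ := hπ.bounds (i := 4) (by simp) (by simp)
  have h₅ := hπ.bounds (i := 5) (by simp) (by simp)
  have h₆ := hπ.bounds (i := 6) (by simp) (by simp)
  unfold code
  interval_cases i <;> norm_num <;> omega

theorem code_div {π : Equiv.Perm ℕ} (hπ : FixesOutside π) (q : ℕ) :
    code π q / 262144 = q := by
  have h₁ := hπ.bounds (i := 1) (by simp) (by simp)
  have h₂ := hπ.bounds (i := 2) (by simp) (by simp)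
  have h₃ := hπ.bounds (i := 3) (by simp) (by simp)
  have h₄ := hπ.bounds (i := 4) (by simp) (by simp)
  have h₅ := hπ.bounds (i := 5) (by simp) (by simp)
  have h₆ := hπ.bounds (i := 6) (by simp) (by simp)
  unfold code
  omega

theorem popped_code {π : Equiv.Perm ℕ} (hπ : FixesOutside π) (q : ℕ) :
    popped (code π q) = code π (q / 4) := by
  have h := code_div hπ q
  have h' := code_div hπ (q / 4)
  unfold popped
  unfold code at *
  omega

theorem code_mul_adjTransposition (π : Equiv.Perm ℕ) (q : ℕ) {a : ℕ} (ha : a < 5)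
    (h : π (a + 1) < π (a + 2)) :
    code π q - 7 * 8 ^ a * (π (a + 2) - π (a + 1)) =
      code (π * adjTransposition (a + 1)) q := by
  unfold code
  interval_cases a <;>
    simp [adjTransposition, Equiv.swap_apply_def] at h ⊢ <;> omega

theorem rank_eq_sum (m n a : ℕ) :
    rank m n a = ∑ i ∈ Finset.range a, memb m (n / 8 ^ i % 8) := by
  induction a generalizing n with
  | zero => rfl
  | succ a ih =>
    rw [rank, ih, Finset.sum_range_succ', add_comm]
    simp [Nat.div_div_eq_div_mul, pow_succ']

/-- The mask `m` describes membership in `A` for the wires `1, …, 6`. -/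
def IsMask (m : ℕ) (A : Finset ℕ) : Prop :=
  ∀ x, 1 ≤ x → x ≤ 6 → memb m x = if x ∈ A then 1 else 0

theorem rank_code {π : Equiv.Perm ℕ} (hπ : FixesOutside π) {m : ℕ} {A : Finset ℕ}
    (hm : IsMask m A) (q : ℕ) {a : ℕ} (ha : a ≤ 6) :
    rank m (code π q) a = ((Finset.Icc 1 a).filter fun p => π p ∈ A).card := by
  rw [rank_eq_sum, Finset.card_filter, Finset.range_eq_Ico, ← Finset.Ico_add_one_right_eq_Icc,
    ← Finset.sum_Ico_add' _ 0 a 1]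
  refine Finset.sum_congr rfl fun i hi => ?_
  have hi' : i < 6 := by have := Finset.mem_Ico.1 hi; omega
  have := hπ.bounds (i := i + 1) (by omega) (by omega)
  rw [code_digit hπ q hi', hm _ this.1 this.2]

theorem step_code {π : Equiv.Perm ℕ} (hπ : FixesOutside π) {m : ℕ} {A : Finset ℕ}
    (hm : IsMask m A) (q : ℕ) {a : ℕ} (ha : a < 5) :
    step m (code π q) a (8 ^ a) =
      if π (a + 2) ≤ π (a + 1) then none else
        if π (a + 1) ∈ A ∧ π (a + 2) ∈ A then
          if q % 4 = ((Finset.Icc 1 (a + 1)).filter fun p => π p ∈ A).card then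
            some (code (π * adjTransposition (a + 1)) (q / 4))
          else none
        else some (code (π * adjTransposition (a + 1)) q) := by
  have hx := hπ.bounds (i := a + 1) (by omega) (by omega)
  have hy := hπ.bounds (i := a + 2) (by omega) (by omega)
  have hπ' := hπ.mul_adjTransposition (a := a + 1) (by omega) (by omega)
  rw [step, ← pow_succ', code_digit hπ q (by omega), code_digit hπ q (by omega), cross,
    rank_code hπ hm q (by omega), code_div hπ, hm _ hx.1 hx.2, hm _ hy.1 hy.2]
  by_cases h : π (a + 2) ≤ π (a + 1)
  · have hb : Nat.ble (π (a + 2)) (π (a + 1)) = true := by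
      rw [Nat.ble_eq]
      exact h
    rw [hb, if_pos h, cond_true]
  · rw [code_mul_adjTransposition π q ha (by omega), popped_code hπ']
    have hb : Nat.ble (π (a + 2)) (π (a + 1)) = false := by
      rw [← Bool.not_eq_true, Nat.ble_eq]
      exact h
    rw [hb, if_neg h]
    have hq : ∀ b, Nat.beq (q % 4) b = decide (q % 4 = b) := fun b => by
      rw [Bool.eq_iff_iff, Nat.beq_eq, decide_eq_true_iff]
    by_cases h₁ : π (a + 1) ∈ A <;> by_cases h₂ : π (a + 2) ∈ A <;>
      simp [h₁, h₂, hq, show Nat.beq 0 2 = false from rfl, show Nat.beq 1 2 = false from rfl,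
        Bool.cond_decide]

theorem code_eq_iff {π : Equiv.Perm ℕ} (hπ : FixesOutside π) (q : ℕ) :
    code π q = 42798 ↔ π = longWord 6 ∧ q = 0 := by
  constructor
  · intro h
    have hq : q = 0 := by rw [← code_div hπ q, h]
    refine ⟨Equiv.ext fun i => ?_, hq⟩
    by_cases hi : 1 ≤ i ∧ i ≤ 6
    · obtain ⟨h₁, h₂⟩ := hi
      obtain ⟨i, rfl⟩ := Nat.exists_eq_add_of_le' h₁
      have hi : i < 6 := by omega
      rw [← code_digit hπ q (by omega), h]
      interval_cases i <;> rfl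
    · rw [hπ i (by omega)]
      simp [longWord, hi]
  · rintro ⟨rfl, rfl⟩
    rfl

theorem card_paths_succ (A : Finset ℕ) (k : ℕ) (π : Equiv.Perm ℕ) (r : List ℕ) :
    (paths A (k + 1) π r).card =
      ∑ a ∈ Finset.range 5, (continuations A k (a + 1) π r).card := by
  have h : paths A (k + 1) π r = (Finset.range 5).biUnion fun a =>
      (continuations A k (a + 1) π r).image (List.cons (a + 1)) := by
    ext w
    simp only [mem_paths, mem_words, Finset.mem_biUnion, Finset.mem_image, Finset.mem_range,
      mem_continuations]
    constructor
    · rintro ⟨⟨hl, hw⟩, h₁, h₂⟩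
      obtain ⟨b, w, rfl⟩ := List.exists_cons_of_length_eq_add_one hl
      obtain ⟨a, rfl⟩ := Nat.exists_eq_add_of_le' (hw b (by simp)).1
      refine ⟨a, ?_, w, ⟨⟨by simpa using hl, fun c hc => hw c (by simp [hc])⟩, ?_, h₂⟩, rfl⟩
      · have := hw (a + 1) (by simp)
        omega
      · simpa [mul_assoc] using h₁
    · rintro ⟨a, ha, w, ⟨⟨hl, hw⟩, h₁, h₂⟩, rfl⟩
      refine ⟨⟨by simpa using hl, ?_⟩, by simpa [mul_assoc] using h₁, h₂⟩
      intro c hc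
      rcases List.mem_cons.1 hc with rfl | hc
      · omega
      · exact hw c hc
  rw [h, Finset.card_biUnion]
  · exact Finset.sum_congr rfl fun a _ => Finset.card_image_of_injective _ List.cons_injective
  · intro a _ b _ hab
    rw [Function.onFun, Finset.disjoint_left]
    simp only [Finset.mem_image]
    rintro _ ⟨w, _, rfl⟩ ⟨w', _, h⟩
    simp at h
    omega

theorem card_paths {m : ℕ} {A : Finset ℕ} (hm : IsMask m A) {k : ℕ} {π : Equiv.Perm ℕ}
    (hπ : FixesOutside π) (hk : inversions (wires π) + k ≤ 15) {r : List ℕ}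
    (hr : ∀ c ∈ r, 1 ≤ c ∧ c ≤ 3) :
    (paths A k π r).card = count m k (code π (pack r)) := by
  induction k generalizing π r with
  | zero =>
    have hp : pack r = 0 ↔ [] = r := by
      cases r with
      | nil => simp [pack]
      | cons c r =>
        have := hr c (by simp)
        simp [pack]
        omega
    have h : ∀ w, w ∈ paths A 0 π r ↔ w = [] ∧ π = longWord 6 ∧ pack r = 0 := by
      intro w
      rw [mem_paths, hp, words, Finset.mem_singleton]
      refine and_congr_right ?_
      rintro rfl
      simp [inducedAux]
    rw [count]
    split_ifs with hc
    · rw [Finset.card_eq_one]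
      exact ⟨[], Finset.ext fun w => by simp [h, ← code_eq_iff hπ, hc]⟩
    · rw [Finset.card_eq_zero, Finset.eq_empty_iff_forall_notMem]
      exact fun w hw => hc ((code_eq_iff hπ _).2 ((h w).1 hw).2)
  | succ k ih =>
    rw [card_paths_succ, count]
    refine Finset.sum_congr rfl fun a ha => ?_
    rw [Finset.mem_range] at ha
    have hπ' := hπ.mul_adjTransposition (a := a + 1) (by omega) (by omega)
    rw [step_code hπ hm _ ha]
    by_cases h : π (a + 2) ≤ π (a + 1)
    · rw [if_pos h, Option.elim_none, Finset.card_eq_zero, Finset.eq_empty_iff_forall_notMem]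
      intro w hw
      rw [mem_continuations, mem_words] at hw
      have := inversions_descent π (a := a + 1) (by omega) (by omega) h
      have := le_inversions_add hw.1.2 hw.2.1
      omega
    · have hk' := inversions_ascent π (a := a + 1) (by omega) (by omega) (not_le.1 h)
      rw [if_neg h, continuations.eq_def]
      by_cases hA : π (a + 1) ∈ A ∧ π (a + 2) ∈ A
      · rw [if_pos hA, if_pos hA]
        have hpos : 0 < ((Finset.Icc 1 (a + 1)).filter fun p => π p ∈ A).card :=
          Finset.card_pos.2 ⟨a + 1, by simp [hA.1]⟩
        cases r with
        | nil =>
          rw [if_neg (by simp only [pack]; omega)]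
          rfl
        | cons c r =>
          have hc := hr c (by simp)
          have e₁ : pack (c :: r) % 4 = c := by rw [pack]; omega
          have e₂ : pack (c :: r) / 4 = pack r := by rw [pack]; omega
          rw [e₁, e₂]
          dsimp only
          split_ifs
          · exact ih hπ' (by omega) fun d hd => hr d (by simp [hd])
          · rfl
      · rw [if_neg hA, if_neg hA]
        exact ih hπ' (by omega) hr

/-- The reduced words whose induced word on `A` is `r`, with `A` given by the mask `m`. -/
theorem card_reduced_induced {m : ℕ} {A : Finset ℕ} (hm : IsMask m A) {r : List ℕ}
    (hr : ∀ c ∈ r, 1 ≤ c ∧ c ≤ 3) :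
    (paths A 15 1 r).card = total m 15 [(219345 + 262144 * pack r, 1)] := by
  rw [card_paths hm (fun _ _ => rfl) (by decide) hr, total_singleton]
  rfl

theorem mem_paths_one {A : Finset ℕ} {r w : List ℕ} :
    w ∈ paths A 15 1 r ↔ IsReducedWord 6 w ∧ inducedWord w A = r := by
  simp [mem_paths, mem_words, IsReducedWord, inducedWord, Nat.choose, and_assoc]

/-- The set of wires described by a mask. -/
def maskSet (m : ℕ) : Finset ℕ := (Finset.Icc 1 6).filter fun x => memb m x = 1

theorem isMask_maskSet (m : ℕ) : IsMask m (maskSet m) := by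
  intro x h₁ h₂
  have : memb m x < 2 := Nat.mod_lt _ (by simp)
  simp only [maskSet, Finset.mem_filter, Finset.mem_Icc]
  split_ifs <;> omega

/-- The masks of the four-element subsets of `{1, …, 6}`. -/
def masks : Finset ℕ :=
  {30, 46, 54, 58, 60, 78, 86, 90, 92, 102, 106, 108, 114, 116, 120}

theorem image_maskSet_masks : masks.image maskSet = Finset.powersetCard 4 (Finset.Icc 1 6) := by
  decide +kernel

theorem maskSet_injOn : Set.InjOn maskSet masks := by
  have : ∀ a ∈ masks, ∀ b ∈ masks, maskSet a = maskSet b → a = b := by decide +kernel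
  exact fun a ha b hb => this a ha b hb

theorem sum_total_masks :
    ∑ m ∈ masks, ∑ r ∈ reentrantSet, total m 15 [(219345 + 262144 * pack r, 1)] = 1098240 := by
  decide +kernel

theorem card_reduced : Nat.card {w : List ℕ // IsReducedWord 6 w} = 292864 := by
  have hm : IsMask 0 ∅ := by
    intro x _ _
    simp [memb]
  have h : ∀ (w : List ℕ) (π : Equiv.Perm ℕ), inducedAux ∅ w π = [] := by
    intro w
    induction w with
    | nil => exact fun _ => rfl
    | cons a w ih => exact fun π => by simp [inducedAux, ih]
  have h' : ∀ w, w ∈ paths ∅ 15 1 [] ↔ IsReducedWord 6 w := by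
    simp [mem_paths_one, inducedWord, h]
  rw [Nat.subtype_card _ h', card_reduced_induced hm (by simp)]
  decide +kernel

theorem card_reentrant_pairs :
    Nat.card {p : List ℕ × Finset ℕ //
        IsReducedWord 6 p.1 ∧ p.2 ⊆ Finset.Icc 1 6 ∧ p.2.card = 4 ∧
          inducedWord p.1 p.2 ∈ reentrantSet} = 1098240 := by
  have h : ∀ p : List ℕ × Finset ℕ,
      p ∈ (Finset.powersetCard 4 (Finset.Icc 1 6)).biUnion (fun A =>
        (reentrantSet.biUnion fun r => paths A 15 1 r).image fun w => (w, A)) ↔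
      IsReducedWord 6 p.1 ∧ p.2 ⊆ Finset.Icc 1 6 ∧ p.2.card = 4 ∧
          inducedWord p.1 p.2 ∈ reentrantSet := by
    rintro ⟨w, A⟩
    simp only [Finset.mem_biUnion, Finset.mem_image, Finset.mem_powersetCard, mem_paths_one,
      Prod.mk.injEq]
    constructor
    · rintro ⟨_, hA, _, ⟨_, hr, hw, rfl⟩, rfl, rfl⟩
      exact ⟨hw, hA.1, hA.2, hr⟩
    · rintro ⟨hw, hA, hA', hr⟩
      exact ⟨A, ⟨hA, hA'⟩, w, ⟨_, hr, hw, rfl⟩, rfl, rfl⟩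
  have hr : ∀ r ∈ reentrantSet, ∀ c ∈ r, 1 ≤ c ∧ c ≤ 3 := by decide
  rw [Nat.subtype_card _ h, Finset.card_biUnion, ← image_maskSet_masks,
    Finset.sum_image maskSet_injOn, ← sum_total_masks]
  · refine Finset.sum_congr rfl fun m _ => ?_
    rw [Finset.card_image_of_injective _ fun _ _ h => congrArg Prod.fst h, Finset.card_biUnion]
    · exact Finset.sum_congr rfl fun r h => card_reduced_induced (isMask_maskSet m) (hr r h)
    · intro r _ s _ hrs
      rw [Function.onFun, Finset.disjoint_left]
      simp only [mem_paths_one]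
      rintro w ⟨_, rfl⟩ ⟨_, h⟩
      exact hrs h
  · intro A _ B _ hAB
    rw [Function.onFun, Finset.disjoint_left]
    simp only [Finset.mem_image]
    rintro _ ⟨w, _, rfl⟩ ⟨w', _, h⟩
    exact hAB (congrArg Prod.snd h).symm

end Reentrant

/-- The number of pairs `(w, A)` with `w` a reduced word for the long word in `S₆`
and `A` a 4-element subset of `{1,…,6}` whose induced word is reentrant is
`1098240`; consequently, with `292864` reduced words in total, the probability of
a reentrant induced word is `1098240 / (C(6,4) * 292864) = 1/4`. -/
theorem reentrant_pairs_S6_count :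
    Nat.card {p : List ℕ × Finset ℕ //
        IsReducedWord 6 p.1 ∧ p.2 ⊆ Finset.Icc 1 6 ∧ p.2.card = 4 ∧
          inducedWord p.1 p.2 ∈ reentrantSet} = 1098240 ∧
    Nat.card {w : List ℕ // IsReducedWord 6 w} = 292864 ∧
    (1098240 : ℚ) / (Nat.choose 6 4 * 292864) = 1 / 4 := by
  exact ⟨Reentrant.card_reentrant_pairs, Reentrant.card_reduced, by norm_num [Nat.choose]⟩
end
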